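/- For every Λ₀ > 0 there exist C(Λ₀) > 0 and 𝔭₀(Λ₀) > 0 such that, if u satisfies the quasi-minimizer hypotheses with momentum 𝔭 ≥ 𝔭₀(Λ₀) and speed c, then ∫_{ℝ²} |∇|u||² dx + (1/2)∫_{ℝ²}(1 − |u|²)² dx ≤ C(Λ₀). -/

import Mathlib

open MeasureTheory Filter Metric

noncomputable section

/-- First partial derivative (direction `x₁`), identifying `ℝ²` with `ℂ`. -/
def pd1 (u : ℂ → ℂ) (z : ℂ) : ℂ := fderiv ℝ u z 1

/-- Second partial derivative (direction `x₂`). -/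
def pd2 (u : ℂ → ℂ) (z : ℂ) : ℂ := fderiv ℝ u z Complex.I

/-- Laplacian `Δu`. -/
def lap (u : ℂ → ℂ) (z : ℂ) : ℂ := fderiv ℝ (pd1 u) z 1 + fderiv ℝ (pd2 u) z Complex.I

/-- `|∇u|²`. -/
def gradSq (u : ℂ → ℂ) (z : ℂ) : ℝ := ‖pd1 u z‖ ^ 2 + ‖pd2 u z‖ ^ 2

/-- Ginzburg–Landau energy density. -/
def energyDensity (u : ℂ → ℂ) (z : ℂ) : ℝ :=
  (1 / 2) * gradSq u z + (1 / 4) * (1 - ‖u z‖ ^ 2) ^ 2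

/-- Ginzburg–Landau energy, valued in `[0,∞]`. -/
def energy (u : ℂ → ℂ) : ENNReal := ∫⁻ z : ℂ, ENNReal.ofReal (energyDensity u z)

/-- `E(u)`, real valued. -/
def Efun (u : ℂ → ℂ) : ℝ := (energy u).toReal

/-- The energy space `ℰ`: (smooth) maps with finite Ginzburg–Landau energy. -/
def memE (u : ℂ → ℂ) : Prop := ContDiff ℝ (⊤ : ℕ∞) u ∧ energy u < ⊤

/-- Momentum density `Re(i ∂₂u (conj u − 1))`. -/
def momDensity (u : ℂ → ℂ) (z : ℂ) : ℝ :=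
  (Complex.I * pd2 u z * ((starRingEnd ℂ) (u z) - 1)).re

/-- Integrability of the momentum density. -/
def momInt (u : ℂ → ℂ) : Prop := Integrable (momDensity u)

/-- The momentum `P₂(u)`. -/
def P2 (u : ℂ → ℂ) : ℝ := (1 / 2) * ∫ z : ℂ, momDensity u z

/-- `(TW_c)(u) = 0`: the travelling wave equation `−ic∂₂u − Δu − (1−|u|²)u = 0`. -/
def TW (c : ℝ) (u : ℂ → ℂ) : Prop :=
  ∀ z : ℂ, -(Complex.I * (c : ℂ) * pd2 u z) - lap u z - ((1 - ‖u z‖ ^ 2 : ℝ) : ℂ) * u z = 0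

/-- `E_min(p)`. -/
def Emin (p : ℝ) : ℝ := sInf (Efun '' {u : ℂ → ℂ | memE u ∧ P2 u = p})

/-- Evenness in `x₁`: `u(−x₁, x₂) = u(x₁, x₂)`. -/
def evenX1 (u : ℂ → ℂ) : Prop := ∀ z : ℂ, u (-((starRingEnd ℂ) z)) = u z

/-- Quasi-minimizer hypotheses (with symmetry), momentum `p` and speed `c`. -/
def QuasiMin (Λ₀ : ℝ) (u : ℂ → ℂ) (p c : ℝ) : Prop :=
  memE u ∧ evenX1 u ∧ 0 < c ∧ TW c u ∧ momInt u ∧ P2 u = p ∧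
  Efun u ≤ 2 * Real.pi * Real.log p + Λ₀

/-- `V1` is the degree-one vortex with (increasing) modulus profile `ρ`. -/
def IsVortex (V1 : ℂ → ℂ) (ρ : ℝ → ℝ) : Prop :=
  ContDiff ℝ (⊤ : ℕ∞) V1 ∧
  (∀ z : ℂ, lap V1 z + V1 z * ((1 - ‖V1 z‖ ^ 2 : ℝ) : ℂ) = 0) ∧
  V1 0 = 0 ∧
  (∀ z : ℂ, z ≠ 0 → V1 z = ((ρ ‖z‖ : ℝ) : ℂ) * (z / (‖z‖ : ℂ))) ∧
  ρ 0 = 0 ∧ StrictMonoOn ρ (Set.Ici 0) ∧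
  (∀ r : ℝ, 0 ≤ r → 0 ≤ ρ r ∧ ρ r < 1) ∧
  Filter.Tendsto ρ Filter.atTop (nhds 1)

/-- Directional derivative of a real function in the direction `e`. -/
def dirD {E : Type*} [NormedAddCommGroup E] [NormedSpace ℝ E] (e : E) (f : E → ℝ) (z : E) : ℝ :=
  fderiv ℝ f z e

section DirD
variable {E : Type*} [NormedAddCommGroup E] [NormedSpace ℝ E]

lemma dirD_contDiff {f : E → ℝ} (hf : ContDiff ℝ (⊤ : ℕ∞) f) (e : E) :
    ContDiff ℝ (⊤ : ℕ∞) (dirD e f) := by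
  have h : ContDiff ℝ (⊤ : ℕ∞) (fderiv ℝ f) := hf.fderiv_right (by simp)
  exact h.clm_apply contDiff_const

lemma smooth_differentiable {F : Type*} [NormedAddCommGroup F] [NormedSpace ℝ F]
    {f : E → F} (hf : ContDiff ℝ (⊤ : ℕ∞) f) : Differentiable ℝ f :=
  hf.differentiable (by simp)

lemma dirD_add {f g : E → ℝ} (hf : Differentiable ℝ f) (hg : Differentiable ℝ g) (e : E) :
    dirD e (fun z => f z + g z) = fun z => dirD e f z + dirD e g z := by
  funext z
  simp only [dirD]
  rw [fderiv_fun_add (hf z) (hg z)]; rfl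

lemma dirD_sub {f g : E → ℝ} (hf : Differentiable ℝ f) (hg : Differentiable ℝ g) (e : E) :
    dirD e (fun z => f z - g z) = fun z => dirD e f z - dirD e g z := by
  funext z
  simp only [dirD]
  rw [fderiv_fun_sub (hf z) (hg z)]; rfl

lemma dirD_mul {f g : E → ℝ} (hf : Differentiable ℝ f) (hg : Differentiable ℝ g) (e : E) :
    dirD e (fun z => f z * g z) = fun z => f z * dirD e g z + dirD e f z * g z := by
  funext z
  simp only [dirD]
  rw [fderiv_fun_mul (hf z) (hg z)]
  simp [mul_comm]

lemma dirD_const_mul {f : E → ℝ} (hf : Differentiable ℝ f) (c : ℝ) (e : E) :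
    dirD e (fun z => c * f z) = fun z => c * dirD e f z := by
  funext z
  simp only [dirD]
  rw [fderiv_const_mul (hf z)]; rfl

lemma dirD_const (c : ℝ) (e : E) : dirD e (fun _ : E => c) = fun _ => 0 := by
  funext z; simp [dirD]

lemma hasDerivAt_line {f : E → ℝ} (hf : Differentiable ℝ f) (z e : E) (t : ℝ) :
    HasDerivAt (fun t : ℝ => f (z + t • e)) (dirD e f (z + t • e)) t := by
  have h1 : HasDerivAt (fun t : ℝ => z + t • e) e t := by
    simpa using ((hasDerivAt_id t).smul_const e).const_add z
  exact (hf (z + t • e)).hasFDerivAt.comp_hasDerivAt t h1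

lemma dirD_comp_affine {E' : Type*} [NormedAddCommGroup E'] [NormedSpace ℝ E']
    {f : E → ℝ} (hf : Differentiable ℝ f) (z₀ : E) (L : E' →L[ℝ] E) (e : E') :
    dirD e (fun z => f (z₀ + L z)) = fun z => dirD (L e) f (z₀ + L z) := by
  funext z
  have h1 : HasFDerivAt (fun z => z₀ + L z) L z := by
    simpa using L.hasFDerivAt.const_add z₀
  have h2 := (hf (z₀ + L z)).hasFDerivAt.comp z h1
  simp only [dirD]
  rw [show (fun z => f (z₀ + L z)) = f ∘ (fun z => z₀ + L z) from rfl, h2.fderiv]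
  rfl

lemma dirD_symm {f : E → ℝ} (hf : ContDiff ℝ (⊤ : ℕ∞) f) (e e' z : E) :
    dirD e (dirD e' f) z = dirD e' (dirD e f) z := by
  have hd : Differentiable ℝ (fderiv ℝ f) :=
    (hf.fderiv_right (m := (⊤ : ℕ∞)) (by simp)).differentiable (by simp)
  have key : ∀ a b : E, dirD a (dirD b f) z = fderiv ℝ (fderiv ℝ f) z a b := by
    intro a b
    have := (hd z).hasFDerivAt.clm_apply (hasFDerivAt_const b z)
    simp only [dirD]
    rw [show (fun z => fderiv ℝ f z b) = fun y => (fderiv ℝ f y) ((fun _ => b) y) from rfl] at *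
    rw [show dirD b f = fun y => (fderiv ℝ f y) ((fun _ => b) y) from rfl, this.fderiv]
    simp
  rw [key, key]
  exact second_derivative_symmetric (fun y => (smooth_differentiable hf y).hasFDerivAt)
    (hd z).hasFDerivAt e e'

end DirD

lemma second_deriv_nonneg_of_isLocalMin {f f1 : ℝ → ℝ} {f2 x : ℝ}
    (h1 : ∀ t, HasDerivAt f (f1 t) t) (h2 : HasDerivAt f1 f2 x) (hm : IsLocalMin f x) :
    0 ≤ f2 := by
  by_contra! hneg
  have e1 : deriv f = f1 := funext fun t => (h1 t).deriv
  have hmax : IsLocalMax f x := by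
    apply isLocalMax_of_deriv_deriv_neg
    · rw [e1, h2.deriv]; exact hneg
    · exact hm.deriv_eq_zero
    · exact (h1 x).continuousAt
  have hc : f =ᶠ[nhds x] fun _ => f x := by
    filter_upwards [hm, hmax] with t ht ht'
    exact le_antisymm ht' ht
  have hc1 : f1 =ᶠ[nhds x] fun _ => 0 := by
    filter_upwards [hc.eventuallyEq_nhds] with t ht
    rw [← (h1 t).deriv, ht.deriv_eq, deriv_const]
  have := hc1.deriv_eq
  rw [h2.deriv, deriv_const] at this
  linarith

section MaxPrinciple
variable {E : Type*} [NormedAddCommGroup E] [NormedSpace ℝ E]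

lemma dirD_dirD_nonneg_of_isLocalMin {f : E → ℝ} (hf : ContDiff ℝ (⊤ : ℕ∞) f) {z : E}
    (hm : IsLocalMin f z) (e : E) : 0 ≤ dirD e (dirD e f) z := by
  have hd := smooth_differentiable (dirD_contDiff hf e)
  have := second_deriv_nonneg_of_isLocalMin (f := fun t : ℝ => f (z + t • e)) (x := 0)
    (fun t => hasDerivAt_line (smooth_differentiable hf) z e t) (hasDerivAt_line hd z e 0) ?_
  · simpa using this
  · have hc : ContinuousAt (fun t : ℝ => z + t • e) 0 := by fun_prop
    have : Tendsto (fun t : ℝ => z + t • e) (nhds 0) (nhds z) := by simpa using hc.tendsto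
    have h := this.eventually hm
    simpa [IsLocalMin, IsMinFilter] using h

lemma dirD_eq_zero_of_isLocalMin {f : E → ℝ} {z : E} (hm : IsLocalMin f z) (e : E) :
    dirD e f z = 0 := by
  simp [dirD, hm.fderiv_eq_zero]

end MaxPrinciple

/-- Laplacian of a real function. -/
def lapR (f : ℂ → ℝ) (z : ℂ) : ℝ := dirD 1 (dirD 1 f) z + dirD Complex.I (dirD Complex.I f) z

lemma contDiff_re : ContDiff ℝ (⊤ : ℕ∞) Complex.re := Complex.reCLM.contDiff
lemma contDiff_im : ContDiff ℝ (⊤ : ℕ∞) Complex.im := Complex.imCLM.contDiff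

lemma dirD_re (e : ℂ) : dirD e Complex.re = fun _ => e.re := by
  funext z
  simp only [dirD]
  rw [show Complex.re = fun z => Complex.reCLM z from rfl, ContinuousLinearMap.fderiv]

lemma dirD_im (e : ℂ) : dirD e Complex.im = fun _ => e.im := by
  funext z
  simp only [dirD]
  rw [show Complex.im = fun z => Complex.imCLM z from rfl, ContinuousLinearMap.fderiv]

/-- A nonnegative function with `Δ F ≥ 2 F (F - β)` on the plane is bounded. -/
lemma bounded_of_laplacian_ge {F : ℂ → ℝ} (hF : ContDiff ℝ (⊤ : ℕ∞) F) {β : ℝ} (hβ : 0 ≤ β)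
    (hF0 : ∀ z, 0 ≤ F z) (hL : ∀ z, 2 * F z * (F z - β) ≤ lapR F z) (z₀ : ℂ) :
    F z₀ ≤ β + 16 := by
  set G : ℂ → ℝ := fun z => F (z₀ + z) with hG
  set ζ : ℂ → ℝ := fun z => 1 - (z.re * z.re + z.im * z.im) with hζ
  have hGs : ContDiff ℝ (⊤ : ℕ∞) G := hF.comp (contDiff_const.add contDiff_id)
  have hζs : ContDiff ℝ (⊤ : ℕ∞) ζ :=
    contDiff_const.sub ((contDiff_re.mul contDiff_re).add (contDiff_im.mul contDiff_im))
  set φ : ℂ → ℝ := fun z => -(1:ℝ) * ((ζ z * ζ z) * G z) with hφ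
  have hφs : ContDiff ℝ (⊤ : ℕ∞) φ := contDiff_const.mul ((hζs.mul hζs).mul hGs)
  have hGL : ∀ (e : ℂ), dirD e (dirD e G) = fun z => dirD e (dirD e F) (z₀ + z) := by
    intro e
    have h1 := dirD_comp_affine (smooth_differentiable hF) z₀ (ContinuousLinearMap.id ℝ ℂ) e
    have h2 := dirD_comp_affine (smooth_differentiable (dirD_contDiff hF e)) z₀
      (ContinuousLinearMap.id ℝ ℂ) e
    simp only [ContinuousLinearMap.coe_id', id_eq] at h1 h2
    rw [hG, h1, h2]
  have dre := smooth_differentiable contDiff_re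
  have dim := smooth_differentiable contDiff_im
  have dζ := smooth_differentiable hζs
  have dG := smooth_differentiable hGs
  have hζ1 : ∀ e, dirD e ζ = fun z => -2 * (z.re * e.re + z.im * e.im) := by
    intro e
    rw [hζ, dirD_sub (differentiable_const _) ((dre.fun_mul dre).fun_add (dim.fun_mul dim)),
      dirD_const, dirD_add (dre.fun_mul dre) (dim.fun_mul dim), dirD_mul dre dre,
      dirD_mul dim dim, dirD_re, dirD_im]
    funext z
    ring
  have hζ2 : ∀ e z, dirD e (dirD e ζ) z = -2 * (e.re * e.re + e.im * e.im) := by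
    intro e z
    rw [hζ1 e]
    have d1 : Differentiable ℝ (fun z : ℂ => z.re * e.re) := dre.fun_mul (differentiable_const _)
    have d2 : Differentiable ℝ (fun z : ℂ => z.im * e.im) := dim.fun_mul (differentiable_const _)
    rw [dirD_const_mul (d1.fun_add d2), dirD_add d1 d2, dirD_mul dre (differentiable_const _),
      dirD_mul dim (differentiable_const _), dirD_const, dirD_const, dirD_re, dirD_im]
    ring
  have hφ1 : ∀ e, dirD e φ = fun z => -(1:ℝ) * ((ζ z * ζ z) * dirD e G z
      + (ζ z * dirD e ζ z + dirD e ζ z * ζ z) * G z) := by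
    intro e
    rw [hφ, dirD_const_mul ((dζ.fun_mul dζ).fun_mul dG), dirD_mul (dζ.fun_mul dζ) dG, dirD_mul dζ dζ]
  have hφ2 : ∀ e z, dirD e (dirD e φ) z = -(1:ℝ) * ((ζ z * ζ z) * dirD e (dirD e G) z
      + 2 * (2 * ζ z * dirD e ζ z) * dirD e G z
      + 2 * (dirD e ζ z * dirD e ζ z + ζ z * dirD e (dirD e ζ) z) * G z) := by
    intro e z
    have dζe := smooth_differentiable (dirD_contDiff hζs e)
    have dGe := smooth_differentiable (dirD_contDiff hGs e)
    rw [hφ1 e, dirD_const_mul (((dζ.fun_mul dζ).fun_mul dGe).fun_add (((dζ.fun_mul dζe).fun_add (dζe.fun_mul dζ)).fun_mul dG)),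
      dirD_add ((dζ.fun_mul dζ).fun_mul dGe) (((dζ.fun_mul dζe).fun_add (dζe.fun_mul dζ)).fun_mul dG),
      dirD_mul (dζ.fun_mul dζ) dGe, dirD_mul ((dζ.fun_mul dζe).fun_add (dζe.fun_mul dζ)) dG,
      dirD_mul dζ dζ, dirD_add (dζ.fun_mul dζe) (dζe.fun_mul dζ), dirD_mul dζ dζe, dirD_mul dζe dζ]
    ring
  obtain ⟨z, hz, hmin⟩ := (isCompact_closedBall (0:ℂ) 1).exists_isMinOn ⟨0, by simp⟩
    hφs.continuous.continuousOn
  have h0 : φ z ≤ φ 0 := hmin (by simp)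
  have hφ0 : φ 0 = - F z₀ := by simp [hφ, hζ, hG]
  by_cases hF00 : F z₀ = 0
  · rw [hF00]; linarith
  have hpos : 0 < F z₀ := lt_of_le_of_ne (hF0 z₀) (Ne.symm hF00)
  have hζz : 0 < ζ z := by
    have hz' : z.re * z.re + z.im * z.im ≤ 1 := by
      have : ‖z‖ ≤ 1 := by simpa using hz
      rw [← Complex.normSq_apply, Complex.normSq_eq_norm_sq]
      nlinarith [norm_nonneg z]
    rcases lt_or_eq_of_le (show 0 ≤ ζ z by simp only [hζ]; linarith) with h | h
    · exact h
    · exfalso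
      have : φ z = 0 := by simp [hφ, ← h]
      linarith
  have hGpos : 0 < G z := by
    by_contra! hle
    have : G z = 0 := le_antisymm hle (hF0 _)
    have : φ z = 0 := by simp [hφ, this]
    linarith
  have hzint : z ∈ ball (0:ℂ) 1 := by
    have : z.re * z.re + z.im * z.im < 1 := by
      simp only [hζ] at hζz; linarith
    rw [← Complex.normSq_apply, Complex.normSq_eq_norm_sq] at this
    rw [mem_ball_zero_iff]
    nlinarith [norm_nonneg z]
  have hloc : IsLocalMin φ z :=
    hmin.isLocalMin (mem_of_superset (isOpen_ball.mem_nhds hzint) ball_subset_closedBall)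
  have hk : ∀ e, 0 ≤ 6 * (dirD e ζ z * dirD e ζ z) * G z
      - 2 * ζ z * dirD e (dirD e ζ) z * G z - ζ z * ζ z * dirD e (dirD e G) z := by
    intro e
    have h1 := dirD_eq_zero_of_isLocalMin hloc e
    have h2 := dirD_dirD_nonneg_of_isLocalMin hφs hloc e
    rw [hφ2] at h2
    rw [hφ1] at h1
    have h3 : ζ z * dirD e G z = - (2 * dirD e ζ z * G z) := by
      have : ζ z * (ζ z * dirD e G z + 2 * dirD e ζ z * G z) = 0 := by linarith
      rcases mul_eq_zero.1 this with h | h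
      · exact absurd h hζz.ne'
      · linarith
    have h4 : 2 * (2 * ζ z * dirD e ζ z) * dirD e G z
        = 4 * dirD e ζ z * (ζ z * dirD e G z) := by ring
    rw [h4, h3] at h2
    linarith
  have h1 := hk 1
  have h2 := hk Complex.I
  rw [hζ2, hGL, hζ1] at h1 h2
  simp only [Complex.one_re, Complex.one_im, Complex.I_re, Complex.I_im] at h1 h2
  have hLz := hL (z₀ + z)
  simp only [lapR] at hLz
  have hGz : F (z₀ + z) = G z := rfl
  rw [hGz] at hLz
  have hζle : ζ z ≤ 1 := by
    simp only [hζ]; nlinarith [mul_self_nonneg z.re, mul_self_nonneg z.im]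
  have hsum : ζ z * ζ z * (2 * G z * (G z - β)) ≤ 32 * G z := by
    have a1 : ζ z * ζ z * (2 * G z * (G z - β)) ≤ ζ z * ζ z *
        (dirD 1 (dirD 1 F) (z₀ + z) + dirD Complex.I (dirD Complex.I F) (z₀ + z)) :=
      mul_le_mul_of_nonneg_left hLz (by positivity)
    have a2 : z.re * z.re + z.im * z.im = 1 - ζ z := by simp only [hζ]; ring
    nlinarith
  have hfin : ζ z * ζ z * G z ≤ β + 16 := by
    have : G z * (ζ z * ζ z * (G z - β)) ≤ G z * 16 := by linarith
    have := le_of_mul_le_mul_left this hGpos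
    nlinarith [mul_nonneg hβ (show 0 ≤ 1 - ζ z * ζ z by nlinarith)]
  have : F z₀ ≤ ζ z * ζ z * G z := by
    have : φ z = - (ζ z * ζ z * G z) := by simp [hφ]
    linarith
  linarith

/-- Interior gradient estimate for the Poisson equation, by reflection and comparison. -/
lemma dirD_le_of_laplacian_le {h : ℂ → ℝ} (hs : ContDiff ℝ (⊤ : ℕ∞) h) {M N : ℝ}
    (hM : ∀ z, |h z| ≤ M) {e₁ e₂ : ℂ}
    (hN : ∀ z, |dirD e₁ (dirD e₁ h) z + dirD e₂ (dirD e₂ h) z| ≤ N) (z₀ : ℂ) :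
    |dirD e₂ h z₀| ≤ 2 * M + (N + 1) / 2 := by
  have hM0 : 0 ≤ M := (abs_nonneg _).trans (hM 0)
  have hN0 : 0 ≤ N := (abs_nonneg _).trans (hN 0)
  let L : ℝ → (ℂ →L[ℝ] ℂ) := fun σ =>
    Complex.reCLM.smulRight e₁ + Complex.imCLM.smulRight (σ • e₂)
  have hL : ∀ σ z, L σ z = z.re • e₁ + z.im • (σ • e₂) := fun σ z => rfl
  let k : ℝ → ℂ → ℝ := fun σ z => h (z₀ + L σ z)
  have hks : ∀ σ, ContDiff ℝ (⊤ : ℕ∞) (k σ) := fun σ =>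
    hs.comp (contDiff_const.add (L σ).contDiff)
  have hk2 : ∀ σ e z, dirD e (dirD e (k σ)) z = dirD (L σ e) (dirD (L σ e) h) (z₀ + L σ z) := by
    intro σ e z
    have h1 := dirD_comp_affine (smooth_differentiable hs) z₀ (L σ) e
    have h2 := dirD_comp_affine (smooth_differentiable (dirD_contDiff hs (L σ e))) z₀ (L σ) e
    rw [show k σ = fun z => h (z₀ + L σ z) from rfl, h1, h2]
  let ψ : ℂ → ℝ := fun z => M * (z.re * z.re) + ((2 * M + (N + 1) / 2) * z.im
    - (M + (N + 1) / 2) * (z.im * z.im))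
  have dre := smooth_differentiable contDiff_re
  have dim := smooth_differentiable contDiff_im
  have hψs : ContDiff ℝ (⊤ : ℕ∞) ψ :=
    (contDiff_const.mul (contDiff_re.mul contDiff_re)).add
      ((contDiff_const.mul contDiff_im).sub (contDiff_const.mul (contDiff_im.mul contDiff_im)))
  have hψ2 : ∀ e z, dirD e (dirD e ψ) z = 2 * M * (e.re * e.re)
      - 2 * (M + (N + 1) / 2) * (e.im * e.im) := by
    intro e z
    have d1 : Differentiable ℝ fun z : ℂ => z.re * z.re := dre.fun_mul dre
    have d2 : Differentiable ℝ fun z : ℂ => z.im * z.im := dim.fun_mul dim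
    have d3 : Differentiable ℝ fun z : ℂ => M * (z.re * z.re) := (differentiable_const _).fun_mul d1
    have d4 : Differentiable ℝ fun z : ℂ => (2 * M + (N + 1) / 2) * z.im :=
      (differentiable_const _).fun_mul dim
    have d5 : Differentiable ℝ fun z : ℂ => (M + (N + 1) / 2) * (z.im * z.im) :=
      (differentiable_const _).fun_mul d2
    have s1 : dirD e ψ = fun z => M * (z.re * e.re + e.re * z.re)
        + ((2 * M + (N + 1) / 2) * e.im - (M + (N + 1) / 2) * (z.im * e.im + e.im * z.im)) := by
      rw [show ψ = fun z => M * (z.re * z.re) + ((2 * M + (N + 1) / 2) * z.im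
        - (M + (N + 1) / 2) * (z.im * z.im)) from rfl, dirD_add d3 (d4.fun_sub d5), dirD_sub d4 d5,
        dirD_const_mul d1, dirD_const_mul dim, dirD_const_mul d2, dirD_mul dre dre,
        dirD_mul dim dim, dirD_re, dirD_im]
    have s2 : dirD e ψ = fun z => (2 * M * e.re) * z.re
        + ((2 * M + (N + 1) / 2) * e.im - (2 * (M + (N + 1) / 2) * e.im) * z.im) := by
      rw [s1]; funext z; ring
    have d6 : Differentiable ℝ fun z : ℂ => (2 * M * e.re) * z.re :=
      (differentiable_const _).fun_mul dre
    have d7 : Differentiable ℝ fun z : ℂ => (2 * (M + (N + 1) / 2) * e.im) * z.im :=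
      (differentiable_const _).fun_mul dim
    rw [s2, dirD_add d6 ((differentiable_const _).fun_sub d7), dirD_sub (differentiable_const _) d7,
      dirD_const_mul dre, dirD_const_mul dim, dirD_const, dirD_re, dirD_im]
    ring
  have key : ∀ (ε : ℝ), |ε| = 1 → ∀ z : ℂ, |z.re| ≤ 1 → 0 ≤ z.im → z.im ≤ 1 →
      0 ≤ ψ z + (ε / 2) * (k 1 z - k (-1) z) := by
    intro ε hε
    set G : ℂ → ℝ := fun z => ψ z + (ε / 2) * (k 1 z - k (-1) z) with hG
    have hGs : ContDiff ℝ (⊤ : ℕ∞) G := hψs.add (contDiff_const.mul ((hks 1).sub (hks (-1))))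
    have hG2 : ∀ e z, dirD e (dirD e G) z = dirD e (dirD e ψ) z
        + (ε / 2) * (dirD e (dirD e (k 1)) z - dirD e (dirD e (k (-1))) z) := by
      intro e z
      have a1 := smooth_differentiable (hks 1)
      have a2 := smooth_differentiable (hks (-1))
      have b1 := smooth_differentiable (dirD_contDiff (hks 1) e)
      have b2 := smooth_differentiable (dirD_contDiff (hks (-1)) e)
      rw [hG, dirD_add (smooth_differentiable hψs) ((differentiable_const _).fun_mul (a1.fun_sub a2)),
        dirD_const_mul (a1.fun_sub a2), dirD_sub a1 a2,
        dirD_add (smooth_differentiable (dirD_contDiff hψs e))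
          ((differentiable_const _).fun_mul (b1.fun_sub b2)),
        dirD_const_mul (b1.fun_sub b2), dirD_sub b1 b2]
    let K : Set ℂ := (Set.Icc (-1:ℝ) 1) ×ℂ (Set.Icc (0:ℝ) 1)
    have hK : IsCompact K := isCompact_Icc.reProdIm isCompact_Icc
    obtain ⟨z, hz, hmin⟩ := hK.exists_isMinOn ⟨0, by simp [K, Complex.mem_reProdIm]⟩
      hGs.continuous.continuousOn
    have hdiff : ∀ z, |(ε / 2) * (k 1 z - k (-1) z)| ≤ M := by
      intro z
      rw [abs_mul, abs_div, hε]
      have := abs_sub (k 1 z) (k (-1) z)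
      have h1 := hM (z₀ + L 1 z)
      have h2 := hM (z₀ + L (-1) z)
      have : |k 1 z - k (-1) z| ≤ M + M := this.trans (add_le_add h1 h2)
      norm_num
      linarith
    have hGz : 0 ≤ G z := by
      simp only [K, Complex.mem_reProdIm, Set.mem_Icc] at hz
      obtain ⟨⟨x1, x2⟩, y1, y2⟩ := hz
      have hd := abs_le.1 (hdiff z)
      rcases eq_or_lt_of_le y1 with hy | hy
      · have : k 1 z = k (-1) z := by simp [k, hL, ← hy]
        simp only [hG, this, ψ, ← hy]
        have := mul_nonneg hM0 (mul_self_nonneg z.re)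
        linarith
      have hquad : 0 ≤ z.im * (1 - z.im) := mul_nonneg y1 (by linarith)
      have hψb : ψ z = M * (z.re * z.re) + M * z.im + (M + (N + 1) / 2) * (z.im * (1 - z.im)) := by
        simp only [ψ]; ring
      have hq2 : 0 ≤ (M + (N + 1) / 2) * (z.im * (1 - z.im)) := mul_nonneg (by linarith) hquad
      rcases eq_or_lt_of_le y2 with hy' | hy'
      · simp only [hG]
        rw [hψb, hy']
        rw [hy'] at hq2
        have := mul_nonneg hM0 (mul_self_nonneg z.re)
        linarith
      have hedge : z.re * z.re = 1 → 0 ≤ G z := by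
        intro hx
        simp only [hG]
        rw [hψb, hx]
        have := mul_nonneg hM0 y1
        linarith
      rcases eq_or_lt_of_le x1 with hx | hx
      · exact hedge (by rw [← hx]; norm_num)
      rcases eq_or_lt_of_le x2 with hx' | hx'
      · exact hedge (by rw [hx']; norm_num)
      exfalso
      have hnhds : K ∈ nhds z := by
        have : (Set.Ioo (-1:ℝ) 1) ×ℂ (Set.Ioo (0:ℝ) 1) ∈ nhds z :=
          (isOpen_Ioo.reProdIm isOpen_Ioo).mem_nhds ⟨⟨hx, hx'⟩, hy, hy'⟩
        exact mem_of_superset this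
          (fun w hw => ⟨Set.Ioo_subset_Icc_self hw.1, Set.Ioo_subset_Icc_self hw.2⟩)
      have hloc : IsLocalMin G z := hmin.isLocalMin hnhds
      have g1 := dirD_dirD_nonneg_of_isLocalMin hGs hloc 1
      have g2 := dirD_dirD_nonneg_of_isLocalMin hGs hloc Complex.I
      rw [hG2, hψ2, hk2, hk2] at g1 g2
      have l1 : ∀ σ, L σ 1 = e₁ := by intro σ; simp [hL]
      have l2 : L 1 Complex.I = e₂ := by simp [hL]
      have l3 : L (-1) Complex.I = -e₂ := by simp [hL]
      have hneg : ∀ z, dirD (-e₂) (dirD (-e₂) h) z = dirD e₂ (dirD e₂ h) z := by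
        intro z
        have : dirD (-e₂) h = fun z => (-1) * dirD e₂ h z := by funext z; simp [dirD]
        rw [this, dirD_const_mul (smooth_differentiable (dirD_contDiff hs e₂))]
        simp [dirD]
      rw [l1, l1] at g1
      rw [l2, l3, hneg] at g2
      simp only [Complex.one_re, Complex.one_im, Complex.I_re, Complex.I_im] at g1 g2
      have n1 := hN (z₀ + L 1 z)
      have n2 := hN (z₀ + L (-1) z)
      have : |(ε / 2) * ((dirD e₁ (dirD e₁ h) (z₀ + L 1 z) + dirD e₂ (dirD e₂ h) (z₀ + L 1 z))
          - (dirD e₁ (dirD e₁ h) (z₀ + L (-1) z) + dirD e₂ (dirD e₂ h) (z₀ + L (-1) z)))| ≤ N := by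
        rw [abs_mul, abs_div, hε]
        have := (abs_sub _ _).trans (add_le_add n1 n2)
        norm_num
        linarith
      have := (abs_le.1 this).2
      linarith
    intro w w1 w2 w3
    exact hGz.trans (hmin ⟨abs_le.1 w1, w2, w3⟩)
  have hodd : ∀ t : ℝ, |t| ≤ 1 → |(1 / 2) * (h (z₀ + t • e₂) - h (z₀ + t • (-e₂)))|
      ≤ (2 * M + (N + 1) / 2) * |t| := by
    have hpos : ∀ t : ℝ, 0 ≤ t → t ≤ 1 → |(1 / 2) * (h (z₀ + t • e₂) - h (z₀ + t • (-e₂)))|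
      ≤ (2 * M + (N + 1) / 2) * t := by
      intro t t0 t1
      have a1 := key 1 (by simp) ⟨0, t⟩ (by simp) t0 t1
      have a2 := key (-1) (by simp) ⟨0, t⟩ (by simp) t0 t1
      have b1 : k 1 ⟨0, t⟩ = h (z₀ + t • e₂) := by simp [k, hL]
      have b2 : k (-1) ⟨0, t⟩ = h (z₀ + t • (-e₂)) := by simp [k, hL]
      rw [b1, b2] at a1 a2
      simp only [ψ] at a1 a2
      have : 0 ≤ (M + (N + 1) / 2) * (t * t) := by positivity
      rw [abs_le]; constructor <;> linarith
    intro t ht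
    rcases le_total 0 t with h0 | h0
    · rw [abs_of_nonneg h0] at ht ⊢
      exact hpos t h0 ht
    · rw [abs_of_nonpos h0] at ht ⊢
      have := hpos (-t) (by linarith) ht
      simp only [neg_smul, smul_neg, neg_neg] at this ⊢
      rw [abs_mul, abs_sub_comm, ← abs_mul]
      exact this
  have hd : HasDerivAt (fun t : ℝ => (1 / 2) * (h (z₀ + t • e₂) - h (z₀ + t • (-e₂))))
      (dirD e₂ h z₀) 0 := by
    have h0 : ∀ e : ℂ, HasDerivAt (fun t : ℝ => h (z₀ + t • e)) (dirD e h z₀) 0 := fun e =>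
      (hasDerivAt_line (smooth_differentiable hs) z₀ e 0).congr_deriv (by simp)
    have hn : dirD (-e₂) h z₀ = - dirD e₂ h z₀ := by simp [dirD]
    refine (((h0 e₂).sub (h0 (-e₂))).const_mul (1 / 2)).congr_deriv ?_
    rw [hn]
    ring
  have := hd.hasFDerivAt.le_of_lip' (C := 2 * M + (N + 1) / 2) (by linarith) ?_
  · rw [ContinuousLinearMap.norm_toSpanSingleton] at this
    simpa using this
  · filter_upwards [Metric.closedBall_mem_nhds (0:ℝ) one_pos] with t ht
    have := hodd t (by simpa using ht)
    simpa using this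

/-- The travelling wave system for the real and imaginary parts `a`, `b`. -/
structure RealTW (c : ℝ) (a b : ℂ → ℝ) : Prop where
  smooth_re : ContDiff ℝ (⊤ : ℕ∞) a
  smooth_im : ContDiff ℝ (⊤ : ℕ∞) b
  eq_re : ∀ z, lapR a z = c * dirD Complex.I b z - (1 - (a z ^ 2 + b z ^ 2)) * a z
  eq_im : ∀ z, lapR b z = - c * dirD Complex.I a z - (1 - (a z ^ 2 + b z ^ 2)) * b z

lemma lapR_mul {f g : ℂ → ℝ} (hf : ContDiff ℝ (⊤ : ℕ∞) f) (hg : ContDiff ℝ (⊤ : ℕ∞) g) (z : ℂ) :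
    lapR (fun z => f z * g z) z = f z * lapR g z + lapR f z * g z
      + 2 * (dirD 1 f z * dirD 1 g z + dirD Complex.I f z * dirD Complex.I g z) := by
  have key : ∀ e : ℂ, dirD e (dirD e (fun z => f z * g z)) z
      = f z * dirD e (dirD e g) z + dirD e (dirD e f) z * g z
        + 2 * (dirD e f z * dirD e g z) := by
    intro e
    have df := smooth_differentiable hf
    have dg := smooth_differentiable hg
    have df' := smooth_differentiable (dirD_contDiff hf e)
    have dg' := smooth_differentiable (dirD_contDiff hg e)
    rw [dirD_mul df dg, dirD_add (df.fun_mul dg') (df'.fun_mul dg), dirD_mul df dg',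
      dirD_mul df' dg]
    ring
  simp only [lapR, key]
  ring

lemma lapR_add {f g : ℂ → ℝ} (hf : ContDiff ℝ (⊤ : ℕ∞) f) (hg : ContDiff ℝ (⊤ : ℕ∞) g) (z : ℂ) :
    lapR (fun z => f z + g z) z = lapR f z + lapR g z := by
  have key : ∀ e : ℂ, dirD e (dirD e (fun z => f z + g z)) z
      = dirD e (dirD e f) z + dirD e (dirD e g) z := by
    intro e
    rw [dirD_add (smooth_differentiable hf) (smooth_differentiable hg),
      dirD_add (smooth_differentiable (dirD_contDiff hf e))
        (smooth_differentiable (dirD_contDiff hg e))]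
  simp only [lapR, key]
  ring

lemma lapR_sub {f g : ℂ → ℝ} (hf : ContDiff ℝ (⊤ : ℕ∞) f) (hg : ContDiff ℝ (⊤ : ℕ∞) g) (z : ℂ) :
    lapR (fun z => f z - g z) z = lapR f z - lapR g z := by
  have key : ∀ e : ℂ, dirD e (dirD e (fun z => f z - g z)) z
      = dirD e (dirD e f) z - dirD e (dirD e g) z := by
    intro e
    rw [dirD_sub (smooth_differentiable hf) (smooth_differentiable hg),
      dirD_sub (smooth_differentiable (dirD_contDiff hf e))
        (smooth_differentiable (dirD_contDiff hg e))]
  simp only [lapR, key]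
  ring

lemma contDiff_cos_im (k : ℝ) : ContDiff ℝ (⊤ : ℕ∞) (fun z : ℂ => Real.cos (k * z.im)) :=
  Real.contDiff_cos.comp (contDiff_const.mul contDiff_im)

lemma contDiff_sin_im (k : ℝ) : ContDiff ℝ (⊤ : ℕ∞) (fun z : ℂ => Real.sin (k * z.im)) :=
  Real.contDiff_sin.comp (contDiff_const.mul contDiff_im)

lemma hasFDerivAt_im (z : ℂ) : HasFDerivAt (fun z : ℂ => z.im) Complex.imCLM z :=
  Complex.imCLM.hasFDerivAt

lemma dirD_cos_im (k : ℝ) (e : ℂ) : dirD e (fun z : ℂ => Real.cos (k * z.im))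
    = fun z => -(k * e.im) * Real.sin (k * z.im) := by
  funext z
  have := ((hasFDerivAt_im z).const_mul k).cos
  simp only [dirD]
  rw [this.fderiv]
  simp
  ring

lemma dirD_sin_im (k : ℝ) (e : ℂ) : dirD e (fun z : ℂ => Real.sin (k * z.im))
    = fun z => (k * e.im) * Real.cos (k * z.im) := by
  funext z
  have := ((hasFDerivAt_im z).const_mul k).sin
  simp only [dirD]
  rw [this.fderiv]
  simp
  ring

lemma lapR_cos_im (k : ℝ) (z : ℂ) : lapR (fun z : ℂ => Real.cos (k * z.im)) z
    = - k ^ 2 * Real.cos (k * z.im) := by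
  simp only [lapR, dirD_cos_im]
  rw [dirD_const_mul (smooth_differentiable (contDiff_sin_im k)),
    dirD_const_mul (smooth_differentiable (contDiff_sin_im k)), dirD_sin_im, dirD_sin_im]
  simp
  ring

lemma lapR_sin_im (k : ℝ) (z : ℂ) : lapR (fun z : ℂ => Real.sin (k * z.im)) z
    = - k ^ 2 * Real.sin (k * z.im) := by
  simp only [lapR, dirD_sin_im]
  rw [dirD_const_mul (smooth_differentiable (contDiff_cos_im k)),
    dirD_const_mul (smooth_differentiable (contDiff_cos_im k)), dirD_cos_im, dirD_cos_im]
  simp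
  ring

namespace RealTW
variable {c : ℝ} {a b : ℂ → ℝ}

lemma sq_modulus_le (h : RealTW c a b) (z : ℂ) : a z ^ 2 + b z ^ 2 ≤ 17 + c ^ 2 / 4 := by
  have ha := h.smooth_re
  have hb := h.smooth_im
  have hF : ContDiff ℝ (⊤ : ℕ∞) (fun z => a z * a z + b z * b z) := (ha.mul ha).add (hb.mul hb)
  have := bounded_of_laplacian_ge hF (β := 1 + c ^ 2 / 4) (by positivity)
    (fun z => add_nonneg (mul_self_nonneg _) (mul_self_nonneg _)) ?_ z
  · linarith
  · intro z
    rw [lapR_add (ha.mul ha) (hb.mul hb), lapR_mul ha ha, lapR_mul hb hb, h.eq_re, h.eq_im]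
    nlinarith [sq_nonneg (dirD Complex.I b z + c / 2 * a z), sq_nonneg (dirD 1 a z),
      sq_nonneg (dirD Complex.I a z - c / 2 * b z), sq_nonneg (dirD 1 b z)]

lemma gradient_le (h : RealTW c a b) (hc0 : 0 ≤ c) (hc : c ≤ 1) (z : ℂ) :
    |dirD 1 a z| ≤ 128 ∧ |dirD 1 b z| ≤ 128 ∧ |dirD Complex.I a z| ≤ 128 ∧
      |dirD Complex.I b z| ≤ 128 := by
  have ha := h.smooth_re
  have hb := h.smooth_im
  have hs : ∀ z, a z ^ 2 + b z ^ 2 ≤ 18 := fun z => (h.sq_modulus_le z).trans (by nlinarith)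
  set k := c / 2 with hk
  have hk2 : c = 2 * k := by rw [hk]; ring
  set C : ℂ → ℝ := fun z => Real.cos (k * z.im) with hC
  set S : ℂ → ℝ := fun z => Real.sin (k * z.im) with hS
  have sC : ContDiff ℝ (⊤ : ℕ∞) C := contDiff_cos_im k
  have sS : ContDiff ℝ (⊤ : ℕ∞) S := contDiff_sin_im k
  have hCS : ∀ z, C z ^ 2 + S z ^ 2 = 1 := fun z => Real.cos_sq_add_sin_sq _
  set v : ℂ → ℝ := fun z => a z * C z - b z * S z with hv
  set w : ℂ → ℝ := fun z => a z * S z + b z * C z with hw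
  have sv : ContDiff ℝ (⊤ : ℕ∞) v := (ha.mul sC).sub (hb.mul sS)
  have sw : ContDiff ℝ (⊤ : ℕ∞) w := (ha.mul sS).add (hb.mul sC)
  have hvw : ∀ z, v z ^ 2 + w z ^ 2 = a z ^ 2 + b z ^ 2 := by
    intro z
    linear_combination (a z ^ 2 + b z ^ 2) * hCS z
  have hvb : ∀ z, |v z| ≤ 5 := fun z =>
    abs_le_of_sq_le_sq (by nlinarith [hvw z, hs z, sq_nonneg (w z)]) (by norm_num)
  have hwb : ∀ z, |w z| ≤ 5 := fun z =>
    abs_le_of_sq_le_sq (by nlinarith [hvw z, hs z, sq_nonneg (v z)]) (by norm_num)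
  have lv : ∀ z, lapR v z = -(1 + k ^ 2 - (a z ^ 2 + b z ^ 2)) * v z := by
    intro z
    rw [hv, lapR_sub (ha.mul sC) (hb.mul sS), lapR_mul ha sC, lapR_mul hb sS, h.eq_re, h.eq_im,
      hC, hS, lapR_cos_im, lapR_sin_im, dirD_cos_im, dirD_sin_im, dirD_cos_im, dirD_sin_im]
    simp only [Complex.one_im, Complex.I_im, hk2]
    ring
  have lw : ∀ z, lapR w z = -(1 + k ^ 2 - (a z ^ 2 + b z ^ 2)) * w z := by
    intro z
    rw [hw, lapR_add (ha.mul sS) (hb.mul sC), lapR_mul ha sS, lapR_mul hb sC, h.eq_re, h.eq_im,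
      hC, hS, lapR_cos_im, lapR_sin_im, dirD_cos_im, dirD_sin_im, dirD_cos_im, dirD_sin_im]
    simp only [Complex.one_im, Complex.I_im, hk2]
    ring
  have hcoef : ∀ z, |-(1 + k ^ 2 - (a z ^ 2 + b z ^ 2))| ≤ 18 := by
    intro z
    rw [abs_le]
    constructor <;> nlinarith [hs z, sq_nonneg (a z), sq_nonneg (b z)]
  have est : ∀ f : ℂ → ℝ, ContDiff ℝ (⊤ : ℕ∞) f → (∀ z, |f z| ≤ 5) →
      (∀ z, lapR f z = -(1 + k ^ 2 - (a z ^ 2 + b z ^ 2)) * f z) →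
      ∀ z, |dirD 1 f z| ≤ 56 ∧ |dirD Complex.I f z| ≤ 56 := by
    intro f sf bf lf z
    have bl : ∀ z, |lapR f z| ≤ 90 := by
      intro z
      rw [lf, abs_mul]
      have := mul_le_mul (hcoef z) (bf z) (abs_nonneg _) (by norm_num)
      linarith
    have e1 := dirD_le_of_laplacian_le sf bf (e₁ := 1) (e₂ := Complex.I) bl z
    have e2 := dirD_le_of_laplacian_le sf bf (e₁ := Complex.I) (e₂ := 1)
      (fun z => by rw [add_comm]; exact bl z) z
    constructor <;> linarith
  have ev := est v sv hvb lv z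
  have ew := est w sw hwb lw z
  have hav : a = fun z => v z * C z + w z * S z := by
    funext z
    simp only [hv, hw]
    linear_combination (- a z) * hCS z
  have hbv : b = fun z => w z * C z - v z * S z := by
    funext z
    simp only [hv, hw]
    linear_combination (- b z) * hCS z
  have dv := smooth_differentiable sv
  have dw := smooth_differentiable sw
  have dC := smooth_differentiable sC
  have dS := smooth_differentiable sS
  have bC : |C z| ≤ 1 := Real.abs_cos_le_one _
  have bS : |S z| ≤ 1 := Real.abs_sin_le_one _
  have bdC : ∀ e : ℂ, |e.im| ≤ 1 → |dirD e C z| ≤ 1 := by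
    intro e he
    rw [hC, dirD_cos_im]
    simp only [abs_mul, abs_neg]
    have : |k| ≤ 1 := by rw [abs_le]; constructor <;> linarith
    exact mul_le_one₀ (mul_le_one₀ this (abs_nonneg _) he) (abs_nonneg _) bS
  have bdS : ∀ e : ℂ, |e.im| ≤ 1 → |dirD e S z| ≤ 1 := by
    intro e he
    rw [hS, dirD_sin_im]
    simp only [abs_mul]
    have : |k| ≤ 1 := by rw [abs_le]; constructor <;> linarith
    exact mul_le_one₀ (mul_le_one₀ this (abs_nonneg _) he) (abs_nonneg _) bC
  have prod : ∀ {x y A B : ℝ}, |x| ≤ A → |y| ≤ B → |x * y| ≤ A * B := by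
    intro x y A B hx hy
    rw [abs_mul]
    exact mul_le_mul hx hy (abs_nonneg _) ((abs_nonneg _).trans hx)
  have main : ∀ e : ℂ, |e.im| ≤ 1 → |dirD e v z| ≤ 56 → |dirD e w z| ≤ 56 →
      |dirD e a z| ≤ 128 ∧ |dirD e b z| ≤ 128 := by
    intro e he h1 h2
    constructor
    · rw [hav, dirD_add (dv.fun_mul dC) (dw.fun_mul dS), dirD_mul dv dC, dirD_mul dw dS]
      have p1 := abs_le.1 (prod (hvb z) (bdC e he))
      have p2 := abs_le.1 (prod h1 bC)
      have p3 := abs_le.1 (prod (hwb z) (bdS e he))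
      have p4 := abs_le.1 (prod h2 bS)
      rw [abs_le]
      constructor <;> linarith
    · rw [hbv, dirD_sub (dw.fun_mul dC) (dv.fun_mul dS), dirD_mul dw dC, dirD_mul dv dS]
      have p1 := abs_le.1 (prod (hwb z) (bdC e he))
      have p2 := abs_le.1 (prod h2 bC)
      have p3 := abs_le.1 (prod (hvb z) (bdS e he))
      have p4 := abs_le.1 (prod h1 bS)
      rw [abs_le]
      constructor <;> linarith
  have m1 := main 1 (by simp) ev.1 ew.1
  have m2 := main Complex.I (by simp) ev.2 ew.2
  exact ⟨m1.1, m1.2, m2.1, m2.2⟩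

end RealTW

lemma dirD_re_comp {u : ℂ → ℂ} (hu : Differentiable ℝ u) (e : ℂ) :
    dirD e (fun z => (u z).re) = fun z => (fderiv ℝ u z e).re := by
  funext z
  have := Complex.reCLM.hasFDerivAt.comp z (hu z).hasFDerivAt
  simp only [dirD]
  rw [show (fun z => (u z).re) = Complex.reCLM ∘ u from rfl, this.fderiv]
  rfl

lemma dirD_im_comp {u : ℂ → ℂ} (hu : Differentiable ℝ u) (e : ℂ) :
    dirD e (fun z => (u z).im) = fun z => (fderiv ℝ u z e).im := by
  funext z
  have := Complex.imCLM.hasFDerivAt.comp z (hu z).hasFDerivAt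
  simp only [dirD]
  rw [show (fun z => (u z).im) = Complex.imCLM ∘ u from rfl, this.fderiv]
  rfl

lemma contDiff_fderiv_apply {u : ℂ → ℂ} (hu : ContDiff ℝ (⊤ : ℕ∞) u) (e : ℂ) :
    ContDiff ℝ (⊤ : ℕ∞) (fun z => fderiv ℝ u z e) := by
  have h : ContDiff ℝ (⊤ : ℕ∞) (fderiv ℝ u) := hu.fderiv_right (by simp)
  exact h.clm_apply contDiff_const

lemma realTW_of_TW {c : ℝ} {u : ℂ → ℂ} (hu : ContDiff ℝ (⊤ : ℕ∞) u) (h : TW c u) :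
    RealTW c (fun z => (u z).re) (fun z => (u z).im) := by
  have du := smooth_differentiable hu
  have d1 := smooth_differentiable (contDiff_fderiv_apply hu 1)
  have d2 := smooth_differentiable (contDiff_fderiv_apply hu Complex.I)
  have hn : ∀ z : ℂ, ‖u z‖ ^ 2 = (u z).re ^ 2 + (u z).im ^ 2 := by
    intro z; rw [← Complex.normSq_eq_norm_sq, Complex.normSq_apply]; ring
  refine ⟨Complex.reCLM.contDiff.comp hu, Complex.imCLM.contDiff.comp hu, ?_, ?_⟩
  · intro z
    have := congrArg Complex.re (h z)
    simp only [lapR, dirD_re_comp du, dirD_im_comp du]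
    rw [dirD_re_comp d1, dirD_re_comp d2]
    simp only [lap, hn, Complex.sub_re, Complex.neg_re, Complex.add_re, Complex.mul_re,
      Complex.mul_im, Complex.I_re, Complex.I_im, Complex.ofReal_re, Complex.ofReal_im,
      Complex.zero_re] at this
    unfold pd1 pd2 at this
    beta_reduce
    linarith
  · intro z
    have := congrArg Complex.im (h z)
    simp only [lapR, dirD_re_comp du, dirD_im_comp du]
    rw [dirD_im_comp d1, dirD_im_comp d2]
    simp only [lap, hn, Complex.sub_im, Complex.neg_im, Complex.add_im, Complex.mul_re,
      Complex.mul_im, Complex.I_re, Complex.I_im, Complex.ofReal_re, Complex.ofReal_im,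
      Complex.zero_im] at this
    unfold pd1 pd2 at this
    beta_reduce
    linarith

lemma volume_reProdIm_Icc (α β : ℝ) :
    volume (Set.Icc (-α) α ×ℂ Set.Icc (-β) β) = ENNReal.ofReal (2 * α) * ENNReal.ofReal (2 * β) := by
  have h := Complex.volume_preserving_equiv_real_prod.measure_preimage
    (s := Set.Icc (-α) α ×ˢ Set.Icc (-β) β) (measurableSet_Icc.prod measurableSet_Icc).nullMeasurableSet
  have e : Complex.measurableEquivRealProd ⁻¹' (Set.Icc (-α) α ×ˢ Set.Icc (-β) β)
      = Set.Icc (-α) α ×ℂ Set.Icc (-β) β := by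
    ext z
    simp only [Complex.measurableEquivRealProd_apply, Set.mem_preimage, Set.mem_prod,
      Complex.mem_reProdIm]
  rw [e] at h
  rw [h, Measure.volume_eq_prod, Measure.prod_prod, Real.volume_Icc, Real.volume_Icc]
  congr 2 <;> ring

lemma hasFDerivAt_re (z : ℂ) : HasFDerivAt (fun z : ℂ => z.re) Complex.reCLM z :=
  Complex.reCLM.hasFDerivAt

lemma dirD_comp_re_mul_comp_im {φ ψ : ℝ → ℝ} (hφ : Differentiable ℝ φ) (hψ : Differentiable ℝ ψ)
    (e z : ℂ) : dirD e (fun z : ℂ => φ z.re * ψ z.im) z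
      = e.re * (deriv φ z.re * ψ z.im) + e.im * (φ z.re * deriv ψ z.im) := by
  have h1 := (hφ z.re).hasDerivAt.comp_hasFDerivAt z (hasFDerivAt_re z)
  have h2 := (hψ z.im).hasDerivAt.comp_hasFDerivAt z (hasFDerivAt_im z)
  have h3 := h1.mul h2
  simp only [dirD]
  rw [show (fun z : ℂ => φ z.re * ψ z.im) = (φ ∘ fun z : ℂ => z.re) * (ψ ∘ fun z : ℂ => z.im) from rfl,
    h3.fderiv]
  simp
  ring

lemma integral_mul_dirD {f g : ℂ → ℝ} (hf : ContDiff ℝ 1 f) (hg : ContDiff ℝ 1 g)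
    (hs : HasCompactSupport f) (e : ℂ) :
    ∫ z, f z * dirD e g z = - ∫ z, dirD e f z * g z := by
  have cf := hf.continuous
  have cg := hg.continuous
  have cdf : Continuous (fun z => fderiv ℝ f z e) :=
    (hf.continuous_fderiv (by simp)).clm_apply continuous_const
  have cdg : Continuous (fun z => fderiv ℝ g z e) :=
    (hg.continuous_fderiv (by simp)).clm_apply continuous_const
  refine integral_mul_fderiv_eq_neg_fderiv_mul_of_integrable ?_ ?_ ?_ ?_ ?_
  · refine (cdf.mul cg).integrable_of_hasCompactSupport (HasCompactSupport.mul_right ?_)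
    exact hs.fderiv_apply (𝕜 := ℝ) e
  · exact (cf.mul cdg).integrable_of_hasCompactSupport hs.mul_right
  · exact (cf.mul cg).integrable_of_hasCompactSupport hs.mul_right
  · exact fun x _ => hf.differentiable (by simp) x
  · exact fun x _ => hg.differentiable (by simp) x

/-- A smooth cutoff with bounded derivative. -/
lemma exists_cutoff : ∃ (χ : ℝ → ℝ) (K : ℝ), ContDiff ℝ 1 χ ∧ 0 ≤ K ∧ (∀ t, |χ t| ≤ 1) ∧
    (∀ t, |t| ≤ 1 → χ t = 1) ∧ (∀ t, 2 ≤ |t| → χ t = 0) ∧ (∀ t, |deriv χ t| ≤ K) ∧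
    (∀ t, 2 < |t| → deriv χ t = 0) ∧ (∀ t, |t| < 1 → deriv χ t = 0) := by
  let χ : ContDiffBump (0 : ℝ) := ⟨1, 2, by norm_num, by norm_num⟩
  have hc : ContDiff ℝ 1 χ := χ.contDiff
  obtain ⟨K, hK⟩ := (hc.continuous_deriv (by simp)).bounded_above_of_compact_support
    χ.hasCompactSupport.deriv
  have h0 : ∀ t, 2 ≤ |t| → χ t = 0 := fun t ht => χ.zero_of_le_dist (by simpa using ht)
  have h1 : ∀ t, |t| ≤ 1 → χ t = 1 := fun t ht => χ.one_of_mem_closedBall (by simpa using ht)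
  refine ⟨χ, K, hc, (norm_nonneg _).trans (hK 0), fun t => ?_, h1, h0, hK, ?_, ?_⟩
  · rw [abs_of_nonneg χ.nonneg]; exact χ.le_one
  · intro t ht
    have : χ =ᶠ[nhds t] fun _ => 0 := by
      filter_upwards [(isOpen_lt continuous_const continuous_abs).mem_nhds ht] with s hs
      exact h0 s (le_of_lt hs)
    rw [this.deriv_eq, deriv_const]
  · intro t ht
    have : χ =ᶠ[nhds t] fun _ => 1 := by
      filter_upwards [(isOpen_lt continuous_abs continuous_const).mem_nhds ht] with s hs
      exact h1 s (le_of_lt hs)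
    rw [this.deriv_eq, deriv_const]

/-- If `A` is integrable, `B` is a sum of an integrable and a square integrable function and
`D = ∂₁A + ∂₂B` has compact support, then `∫ A = - ∫ x₁ D`. -/
lemma integral_eq_neg_integral_re_mul_divergence {A B Lf Mf : ℂ → ℝ} (hA : ContDiff ℝ 1 A)
    (hB : ContDiff ℝ 1 B) (iA : Integrable A) (iL : Integrable Lf)
    (iM : Integrable fun z => Mf z ^ 2) (hLM : ∀ z, |B z| ≤ Lf z + Mf z) {ρ : ℝ}
    (hD : ∀ z : ℂ, ρ < ‖z‖ → dirD 1 A z + dirD Complex.I B z = 0) :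
    ∫ z, A z = - ∫ z, z.re * (dirD 1 A z + dirD Complex.I B z) := by
  obtain ⟨χ, K, hχ, hK0, hχ1, hχin, hχout, hdχ, hdχout, hdχin⟩ := exists_cutoff
  have dχ : Differentiable ℝ χ := hχ.differentiable (by simp)
  let φ : ℝ → ℝ → ℝ := fun R t => t * χ (R⁻¹ * t)
  let ψ : ℝ → ℝ → ℝ := fun R t => χ ((R ^ 5)⁻¹ * t)
  have cφ : ∀ R, ContDiff ℝ 1 (φ R) := fun R => contDiff_id.mul (hχ.comp (contDiff_const.mul contDiff_id))
  have cψ : ∀ R, ContDiff ℝ 1 (ψ R) := fun R => hχ.comp (contDiff_const.mul contDiff_id)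
  have hlin : ∀ (k t : ℝ), HasDerivAt (fun t => χ (k * t)) (deriv χ (k * t) * k) t := by
    intro k t
    exact (dχ (k * t)).hasDerivAt.comp t (((hasDerivAt_id t).const_mul k).congr_deriv (by simp))
  have dφ : ∀ R t, deriv (φ R) t = χ (R⁻¹ * t) + R⁻¹ * t * deriv χ (R⁻¹ * t) := by
    intro R t
    have := ((hasDerivAt_id t).mul (hlin R⁻¹ t)).deriv
    simp only [φ]
    rw [show (fun t => t * χ (R⁻¹ * t)) = id * (fun t => χ (R⁻¹ * t)) from rfl, this]
    simp
    ring
  have dψ : ∀ R t, deriv (ψ R) t = (R ^ 5)⁻¹ * deriv χ ((R ^ 5)⁻¹ * t) := by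
    intro R t
    rw [(hlin _ t).deriv]; ring
  let ξ : ℝ → ℂ → ℝ := fun R z => φ R z.re * ψ R z.im
  have cξ : ∀ R, ContDiff ℝ 1 (ξ R) := fun R =>
    ((cφ R).comp (contDiff_re.of_le (by exact_mod_cast le_top))).mul
      ((cψ R).comp (contDiff_im.of_le (by exact_mod_cast le_top)))
  have hdξ : ∀ R e z, dirD e (ξ R) z = e.re * (deriv (φ R) z.re * ψ R z.im)
      + e.im * (φ R z.re * deriv (ψ R) z.im) := fun R e z =>
    dirD_comp_re_mul_comp_im ((cφ R).differentiable (by simp)) ((cψ R).differentiable (by simp)) e z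
  let bx : ℝ → Set ℂ := fun R => Set.Icc (-(2 * R)) (2 * R) ×ℂ Set.Icc (-(2 * R ^ 5)) (2 * R ^ 5)
  have hbx : ∀ R : ℝ, 0 < R → ∀ z, z ∉ bx R → 2 < |R⁻¹ * z.re| ∨ 2 < |(R ^ 5)⁻¹ * z.im| := by
    intro R hR z hz
    by_contra! hcon
    apply hz
    rw [abs_mul, abs_mul, abs_of_pos (inv_pos.2 hR), abs_of_pos (inv_pos.2 (pow_pos hR 5)),
      inv_mul_le_iff₀ hR, inv_mul_le_iff₀ (pow_pos hR 5)] at hcon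
    rw [Complex.mem_reProdIm]
    exact ⟨abs_le.1 (by linarith), abs_le.1 (by linarith)⟩
  have cbx : ∀ R, IsCompact (bx R) := fun R => isCompact_Icc.reProdIm isCompact_Icc
  have sξ : ∀ R, 0 < R → HasCompactSupport (ξ R) := by
    intro R hR
    refine HasCompactSupport.intro (cbx R) fun z hz => ?_
    rcases hbx R hR z hz with h | h
    · simp [ξ, φ, hχout _ h.le]
    · simp [ξ, ψ, hχout _ h.le]
  have cdA : Continuous (fun z => dirD 1 A z) :=
    (hA.continuous_fderiv (by simp)).clm_apply continuous_const
  have cdB : Continuous (fun z => dirD Complex.I B z) :=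
    (hB.continuous_fderiv (by simp)).clm_apply continuous_const
  have cdξ : ∀ R e, Continuous (fun z => dirD e (ξ R) z) := fun R e =>
    ((cξ R).continuous_fderiv (by simp)).clm_apply continuous_const
  have ibp : ∀ R, 0 < R → ∫ z, ξ R z * (dirD 1 A z + dirD Complex.I B z)
      = - (∫ z, dirD 1 (ξ R) z * A z) - ∫ z, dirD Complex.I (ξ R) z * B z := by
    intro R hR
    simp_rw [mul_add]
    rw [integral_add, integral_mul_dirD (cξ R) hA (sξ R hR), integral_mul_dirD (cξ R) hB (sξ R hR)]
    · ring
    · exact ((cξ R).continuous.mul cdA).integrable_of_hasCompactSupport (sξ R hR).mul_right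
    · exact ((cξ R).continuous.mul cdB).integrable_of_hasCompactSupport (sξ R hR).mul_right
  have bφ : ∀ R, 0 < R → ∀ t, |φ R t| ≤ 2 * R := by
    intro R hR t
    by_cases h : 2 ≤ |R⁻¹ * t|
    · simp only [φ, hχout _ h, mul_zero, abs_zero]; positivity
    · push Not at h
      rw [abs_mul, abs_of_pos (inv_pos.2 hR), inv_mul_lt_iff₀ hR] at h
      simp only [φ, abs_mul]
      calc |t| * |χ (R⁻¹ * t)| ≤ (R * 2) * 1 := mul_le_mul h.le (hχ1 _) (abs_nonneg _) (by positivity)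
        _ = 2 * R := by ring
  have bdφ : ∀ R t, |deriv (φ R) t| ≤ 1 + 2 * K := by
    intro R t
    rw [dφ]
    refine (abs_add_le _ _).trans (add_le_add (hχ1 _) ?_)
    by_cases h : 2 < |R⁻¹ * t|
    · simp only [hdχout _ h, mul_zero, abs_zero]; positivity
    · push Not at h
      rw [abs_mul]
      exact mul_le_mul h (hdχ _) (abs_nonneg _) (by norm_num)
  -- the three limits
  have lim1 : Tendsto (fun R => ∫ z, dirD 1 (ξ R) z * A z) atTop (nhds (∫ z, A z)) := by
    refine tendsto_integral_filter_of_dominated_convergence (fun z => (1 + 2 * K) * ‖A z‖) ?_ ?_ ?_ ?_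
    · exact Eventually.of_forall fun R => ((cdξ R 1).mul hA.continuous).aestronglyMeasurable
    · refine Eventually.of_forall fun R => Eventually.of_forall fun z => ?_
      rw [norm_mul]
      refine mul_le_mul_of_nonneg_right ?_ (norm_nonneg _)
      rw [hdξ]
      simp only [Complex.one_re, Complex.one_im, one_mul, zero_mul, add_zero, Real.norm_eq_abs, abs_mul]
      calc _ ≤ (1 + 2 * K) * 1 := mul_le_mul (bdφ _ _) (hχ1 _) (abs_nonneg _) (by positivity)
        _ = _ := by ring
    · exact iA.norm.const_mul _
    · refine Eventually.of_forall fun z => tendsto_const_nhds.congr' ?_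
      filter_upwards [eventually_gt_atTop (max 1 (max |z.re| |z.im|))] with R hR
      simp only [max_lt_iff] at hR
      obtain ⟨h1, h2, h3⟩ := hR
      have R0 : 0 < R := by linarith
      have e1 : |R⁻¹ * z.re| < 1 := by
        rw [abs_mul, abs_of_pos (inv_pos.2 R0), inv_mul_lt_iff₀ R0]; linarith
      have e2 : |(R ^ 5)⁻¹ * z.im| ≤ 1 := by
        rw [abs_mul, abs_of_pos (inv_pos.2 (pow_pos R0 5)), inv_mul_le_iff₀ (pow_pos R0 5)]
        have := le_self_pow₀ h1.le (n := 5) (by norm_num)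
        linarith
      rw [hdξ, dφ]
      simp [ψ, hχin _ e1.le, hdχin _ e1, hχin _ e2]
  have lim2 : Tendsto (fun R => ∫ z, dirD Complex.I (ξ R) z * B z) atTop (nhds 0) := by
    have bound : ∀ R : ℝ, 1 < R → |∫ z, dirD Complex.I (ξ R) z * B z|
        ≤ K * (2 * (∫ z, ‖Lf z‖) + 16 + ∫ z, Mf z ^ 2) * R⁻¹ := by
      intro R hR
      have R0 : 0 < R := by linarith
      have vol : volume.real (bx R) = 16 * R ^ 6 := by
        rw [Measure.real, volume_reProdIm_Icc, ← ENNReal.ofReal_mul (by positivity),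
          ENNReal.toReal_ofReal (by positivity)]
        ring
      have mbx : MeasurableSet (bx R) := (cbx R).measurableSet
      have i1 : Integrable (Set.indicator (bx R) fun _ => (R ^ 3)⁻¹) :=
        (continuousOn_const.integrableOn_compact (cbx R)).integrable_indicator mbx
      have i2 : Integrable fun z => Set.indicator (bx R) (fun _ => (R ^ 3)⁻¹) z + R ^ 3 * Mf z ^ 2 :=
        i1.add (iM.const_mul (R ^ 3))
      have iG : Integrable fun z => K * (R ^ 4)⁻¹ * (2 * ‖Lf z‖
          + (Set.indicator (bx R) (fun _ => (R ^ 3)⁻¹) z + R ^ 3 * Mf z ^ 2)) :=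
        ((iL.norm.const_mul 2).add i2).const_mul _
      have b1 : |∫ z, dirD Complex.I (ξ R) z * B z| ≤ ∫ z, K * (R ^ 4)⁻¹ * (2 * ‖Lf z‖
          + (Set.indicator (bx R) (fun _ => (R ^ 3)⁻¹) z + R ^ 3 * Mf z ^ 2)) := by
        rw [← Real.norm_eq_abs]
        refine norm_integral_le_of_norm_le iG (Eventually.of_forall fun z => ?_)
        rw [hdξ, dψ]
        simp only [Complex.I_re, Complex.I_im, one_mul, zero_mul, zero_add, norm_mul, Real.norm_eq_abs]
        by_cases hz : z ∈ bx R
        · rw [Set.indicator_of_mem hz, abs_of_pos (inv_pos.2 (pow_pos R0 5))]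
          have hb : |B z| ≤ |Lf z| + ((R ^ 3)⁻¹ + R ^ 3 * Mf z ^ 2) / 2 := by
            have h1 := hLM z
            have h2 := le_abs_self (Lf z)
            have h3 : Mf z ≤ ((R ^ 3)⁻¹ + R ^ 3 * Mf z ^ 2) / 2 := by
              have hx : 0 < R ^ 3 := pow_pos R0 3
              have := mul_nonneg (inv_nonneg.2 hx.le) (sq_nonneg (1 - R ^ 3 * Mf z))
              have e : (R ^ 3)⁻¹ * (1 - R ^ 3 * Mf z) ^ 2
                  = (R ^ 3)⁻¹ - 2 * Mf z + R ^ 3 * Mf z ^ 2 := by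
                field_simp
                ring
              linarith
            linarith
          have hp : |φ R z.re| * ((R ^ 5)⁻¹ * |deriv χ ((R ^ 5)⁻¹ * z.im)|) ≤ 2 * K * (R ^ 4)⁻¹ := by
            calc _ ≤ (2 * R) * ((R ^ 5)⁻¹ * K) := by
                  gcongr
                  · exact bφ R R0 _
                  · exact hdχ _
              _ = _ := by field_simp
          calc _ ≤ (2 * K * (R ^ 4)⁻¹) * (|Lf z| + ((R ^ 3)⁻¹ + R ^ 3 * Mf z ^ 2) / 2) :=
                mul_le_mul hp hb (abs_nonneg _) (by positivity)
            _ = _ := by ring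
        · have h0 : φ R z.re * deriv χ ((R ^ 5)⁻¹ * z.im) = 0 := by
            rcases hbx R R0 z hz with h | h
            · simp [φ, hχout _ h.le]
            · simp [hdχout _ h]
          have : |φ R z.re| * (|(R ^ 5)⁻¹| * |deriv χ ((R ^ 5)⁻¹ * z.im)|) = 0 := by
            rw [mul_left_comm, ← abs_mul, h0]; simp
          rw [this, zero_mul, Set.indicator_of_notMem hz]
          positivity
      refine b1.trans ?_
      rw [integral_const_mul, integral_add (iL.norm.const_mul 2) i2,
        integral_add i1 (iM.const_mul (R ^ 3)), integral_const_mul, integral_const_mul,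
        integral_indicator_const _ mbx, vol]
      have q1 : 0 ≤ ∫ z, ‖Lf z‖ := integral_nonneg fun _ => norm_nonneg _
      have q2 : 0 ≤ ∫ z, Mf z ^ 2 := integral_nonneg fun _ => sq_nonneg _
      have r1 : (R ^ 4)⁻¹ ≤ R⁻¹ := inv_anti₀ R0 (le_self_pow₀ hR.le (by norm_num))
      have e : K * (R ^ 4)⁻¹ * (2 * (∫ z, ‖Lf z‖) + ((16 * R ^ 6) • (R ^ 3)⁻¹ + R ^ 3 * ∫ z, Mf z ^ 2))
          = K * (2 * (∫ z, ‖Lf z‖) * (R ^ 4)⁻¹ + (16 + ∫ z, Mf z ^ 2) * R⁻¹) := by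
        simp only [smul_eq_mul]
        field_simp
      rw [e]
      have : K * (2 * (∫ z, ‖Lf z‖) * (R ^ 4)⁻¹ + (16 + ∫ z, Mf z ^ 2) * R⁻¹)
        ≤ K * (2 * (∫ z, ‖Lf z‖) * R⁻¹ + (16 + ∫ z, Mf z ^ 2) * R⁻¹) := by gcongr
      linarith
    refine squeeze_zero_norm' (a := fun R : ℝ =>
      K * (2 * (∫ z, ‖Lf z‖) + 16 + ∫ z, Mf z ^ 2) * R⁻¹) ?_ ?_
    · filter_upwards [eventually_gt_atTop 1] with R hR using bound R hR
    · simpa using tendsto_inv_atTop_zero.const_mul (K * (2 * (∫ z, ‖Lf z‖) + 16 + ∫ z, Mf z ^ 2))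
  have lim3 : Tendsto (fun R => ∫ z, ξ R z * (dirD 1 A z + dirD Complex.I B z)) atTop
      (nhds (∫ z, z.re * (dirD 1 A z + dirD Complex.I B z))) := by
    refine tendsto_const_nhds.congr' ?_
    filter_upwards [eventually_gt_atTop (max 1 ρ)] with R hR
    rw [max_lt_iff] at hR
    obtain ⟨h1, h2⟩ := hR
    have R0 : 0 < R := by linarith
    congr 1
    funext z
    by_cases hz : ρ < ‖z‖
    · rw [hD z hz]; simp
    · have e1 : |R⁻¹ * z.re| ≤ 1 := by
        rw [abs_mul, abs_of_pos (inv_pos.2 R0), inv_mul_le_iff₀ R0]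
        linarith [Complex.abs_re_le_norm z]
      have e2 : |(R ^ 5)⁻¹ * z.im| ≤ 1 := by
        rw [abs_mul, abs_of_pos (inv_pos.2 (pow_pos R0 5)), inv_mul_le_iff₀ (pow_pos R0 5)]
        have := le_self_pow₀ h1.le (n := 5) (by norm_num)
        linarith [Complex.abs_im_le_norm z]
      simp [ξ, φ, ψ, hχin _ e1, hχin _ e2]
  have lim4 := (lim1.neg.sub lim2).congr' (f₂ := fun R => ∫ z, ξ R z * (dirD 1 A z + dirD Complex.I B z)) (by
    filter_upwards [eventually_gt_atTop 0] with R hR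
    rw [ibp R hR])
  have := tendsto_nhds_unique lim3 lim4
  linarith

/-- A smooth truncation `g` of `s ↦ 1 / s`. -/
structure Regularizer (g : ℝ → ℝ) (K : ℝ) : Prop where
  smooth : ContDiff ℝ (⊤ : ℕ∞) g
  nonneg : 0 ≤ K
  eq_inv : ∀ s, 1 / 4 ≤ s → g s = 1 / s
  bound : ∀ s, |g s| ≤ K
  deriv_bound : ∀ s, |g s + s * deriv g s| ≤ K
  deriv_eq : ∀ s, 1 / 4 < s → g s + s * deriv g s = 0
  nonneg_and_mul_le : ∀ s, 0 ≤ s → 0 ≤ g s ∧ s * g s ≤ 1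

lemma exists_regularizer : ∃ g K, Regularizer g K := by
  let χ : ContDiffBump (0 : ℝ) := ⟨1 / 8, 1 / 4, by norm_num, by norm_num⟩
  let g : ℝ → ℝ := fun s => (1 - χ s) / s
  have h1 : ∀ t, |t| ≤ 1 / 8 → χ t = 1 := fun t ht =>
    χ.one_of_mem_closedBall (by rw [mem_closedBall, dist_zero_right]; exact ht)
  have h0 : ∀ t, 1 / 4 ≤ |t| → χ t = 0 := fun t ht =>
    χ.zero_of_le_dist (by rw [dist_zero_right]; exact ht)
  have hs : ContDiff ℝ (⊤ : ℕ∞) g := by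
    rw [contDiff_iff_contDiffAt]
    intro s
    by_cases h : s = 0
    · subst h
      have : g =ᶠ[nhds 0] fun _ => 0 := by
        filter_upwards [closedBall_mem_nhds (0 : ℝ) (by norm_num : (0 : ℝ) < 1 / 8)] with t ht
        simp [g, h1 t (by simpa using ht)]
      exact contDiffAt_const.congr_of_eventuallyEq this
    · exact (contDiffAt_const.sub χ.contDiff.contDiffAt).div contDiffAt_id h
  have hg : ∀ s, 1 / 4 ≤ s → g s = 1 / s := by
    intro s hs
    simp [g, h0 s (hs.trans (le_abs_self s))]
  have hd : ∀ s, g s + s * deriv g s = - deriv χ s := by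
    intro s
    have e : (fun s => s * g s) = fun s => 1 - χ s := by
      funext t
      by_cases h : t = 0
      · subst h; simp [h1 0 (by norm_num)]
      · simp only [g]; field_simp
    have d1 := ((hasDerivAt_id s).mul (smooth_differentiable hs s).hasDerivAt).deriv
    rw [show id * g = fun s => 1 - χ s from e] at d1
    have dχ : DifferentiableAt ℝ χ s := (χ.contDiff (n := 1)).differentiable (by simp) s
    rw [deriv_const_sub] at d1
    simp at d1
    linarith
  obtain ⟨K, hK⟩ := ((χ.contDiff (n := 1)).continuous_deriv (by simp)).bounded_above_of_compact_support
    χ.hasCompactSupport.deriv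
  have K0 : 0 ≤ K := (norm_nonneg _).trans (hK 0)
  refine ⟨g, K + 8, hs, by linarith, hg, ?_, ?_, ?_, ?_⟩
  · intro s
    have b1 : |1 - χ s| ≤ 1 := by
      rw [abs_le]; constructor <;> linarith [χ.le_one (x := s), χ.nonneg (x := s)]
    by_cases h : |s| ≤ 1 / 8
    · simp only [g, h1 s h]; simp; linarith
    · push Not at h
      have : |g s| ≤ 8 := by
        simp only [g, abs_div]
        rw [div_le_iff₀ (by linarith)]
        linarith
      linarith
  · intro s
    rw [hd, abs_neg]
    have := hK s
    rw [Real.norm_eq_abs] at this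
    linarith
  · intro s h
    have : g =ᶠ[nhds s] fun t => 1 / t := by
      filter_upwards [lt_mem_nhds h] with t ht using hg t ht.le
    have hs0 : s ≠ 0 := by linarith
    rw [this.deriv_eq, hg s h.le]
    simp
    field_simp
    norm_num
  · intro s hs0
    have l1 := χ.le_one (x := s)
    have l2 := χ.nonneg (x := s)
    refine ⟨div_nonneg (by linarith) hs0, ?_⟩
    rcases hs0.eq_or_lt with rfl | hpos
    · simp
    · simp only [g]
      rw [mul_div_cancel₀ _ hpos.ne']
      linarith

section Current
variable {E : Type*} [NormedAddCommGroup E] [NormedSpace ℝ E]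

lemma dirD_comp {g : ℝ → ℝ} {f : E → ℝ} (hg : Differentiable ℝ g) (hf : Differentiable ℝ f) (e : E) :
    dirD e (fun z => g (f z)) = fun z => deriv g (f z) * dirD e f z := by
  funext z
  have := (hg (f z)).hasDerivAt.comp_hasFDerivAt z (hf z).hasFDerivAt
  simp only [dirD]
  rw [show (fun z => g (f z)) = g ∘ f from rfl, this.fderiv]
  simp

/-- The current `a ∂b - b ∂a` in the direction `e`, weighted by `g (a² + b²)`. -/
def current (g : ℝ → ℝ) (a b : E → ℝ) (e : E) (z : E) : ℝ :=
  g (a z * a z + b z * b z) * (a z * dirD e b z - b z * dirD e a z)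

/-- The Jacobian of the map `(a, b)`, weighted by the derivative of `s g(s)` at `s = a² + b²`. -/
def wJac (g : ℝ → ℝ) (a b : E → ℝ) (e e' : E) (z : E) : ℝ :=
  (g (a z * a z + b z * b z) + (a z * a z + b z * b z) * deriv g (a z * a z + b z * b z)) *
    (dirD e a z * dirD e' b z - dirD e' a z * dirD e b z)

variable {g : ℝ → ℝ} {a b : E → ℝ}

lemma current_contDiff (hg : ContDiff ℝ (⊤ : ℕ∞) g) (ha : ContDiff ℝ (⊤ : ℕ∞) a)
    (hb : ContDiff ℝ (⊤ : ℕ∞) b) (e : E) : ContDiff ℝ (⊤ : ℕ∞) (current g a b e) :=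
  (hg.comp ((ha.mul ha).add (hb.mul hb))).mul
    ((ha.mul (dirD_contDiff hb e)).sub (hb.mul (dirD_contDiff ha e)))

lemma wJac_continuous (hg : ContDiff ℝ (⊤ : ℕ∞) g) (ha : ContDiff ℝ (⊤ : ℕ∞) a)
    (hb : ContDiff ℝ (⊤ : ℕ∞) b) (e e' : E) : Continuous (wJac g a b e e') := by
  have h1 : Continuous (deriv g) := hg.continuous_deriv (by simp)
  have h2 := hg.continuous
  have h3 := ha.continuous
  have h4 := hb.continuous
  have h5 := fun e => (dirD_contDiff ha e).continuous
  have h6 := fun e => (dirD_contDiff hb e).continuous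
  unfold wJac
  fun_prop

lemma curl_current (hg : ContDiff ℝ (⊤ : ℕ∞) g) (ha : ContDiff ℝ (⊤ : ℕ∞) a)
    (hb : ContDiff ℝ (⊤ : ℕ∞) b) (e e' z : E) :
    dirD e (current g a b e') z - dirD e' (current g a b e) z = 2 * wJac g a b e e' z := by
  have da := smooth_differentiable ha
  have db := smooth_differentiable hb
  have dg := smooth_differentiable hg
  have da' := fun e => smooth_differentiable (dirD_contDiff ha e)
  have db' := fun e => smooth_differentiable (dirD_contDiff hb e)
  have ds := (da.fun_mul da).fun_add (db.fun_mul db)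
  have key : ∀ e e' : E, dirD e (current g a b e') z
      = g (a z * a z + b z * b z) * (dirD e a z * dirD e' b z - dirD e b z * dirD e' a z
          + (a z * dirD e (dirD e' b) z - b z * dirD e (dirD e' a) z))
        + deriv g (a z * a z + b z * b z) * (2 * (a z * dirD e a z + b z * dirD e b z))
          * (a z * dirD e' b z - b z * dirD e' a z) := by
    intro e e'
    have h1 : dirD e (fun z => g (a z * a z + b z * b z))
        = fun z => deriv g (a z * a z + b z * b z) * (2 * (a z * dirD e a z + b z * dirD e b z)) := by
      rw [dirD_comp (f := fun z => a z * a z + b z * b z) dg ds,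
        dirD_add (da.fun_mul da) (db.fun_mul db), dirD_mul da da, dirD_mul db db]
      funext z
      ring
    have h2 : Differentiable ℝ (fun z => g (a z * a z + b z * b z)) := dg.comp ds
    rw [show current g a b e' = fun z => g (a z * a z + b z * b z)
        * (a z * dirD e' b z - b z * dirD e' a z) from rfl,
      dirD_mul h2 ((da.fun_mul (db' e')).fun_sub (db.fun_mul (da' e'))), h1,
      dirD_sub (da.fun_mul (db' e')) (db.fun_mul (da' e')), dirD_mul da (db' e'), dirD_mul db (da' e')]
    ring
  rw [key, key, dirD_symm ha e' e, dirD_symm hb e' e, wJac]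
  ring

end Current

/-- `|∇a|² + |∇b|²`. -/
def grad2 (a b : ℂ → ℝ) (z : ℂ) : ℝ :=
  dirD 1 a z ^ 2 + dirD 1 b z ^ 2 + (dirD Complex.I a z ^ 2 + dirD Complex.I b z ^ 2)

/-- `(1 - |u|²)²`. -/
def pot (a b : ℂ → ℝ) (z : ℂ) : ℝ := (1 - (a z ^ 2 + b z ^ 2)) ^ 2

/-- The density of `2 P₂`. -/
def momDens (a b : ℂ → ℝ) (z : ℂ) : ℝ :=
  dirD Complex.I b z - (a z * dirD Complex.I b z - b z * dirD Complex.I a z)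

/-- Finite energy solutions of the travelling wave system with integrable momentum. -/
structure FinTW (c : ℝ) (a b : ℂ → ℝ) : Prop extends RealTW c a b where
  speed_pos : 0 < c
  int_grad : Integrable (grad2 a b)
  int_pot : Integrable (pot a b)
  int_mom : Integrable (momDens a b)

namespace FinTW
variable {c : ℝ} {a b : ℂ → ℝ}

lemma int_sq (h : FinTW c a b) : Integrable (fun z => dirD 1 a z ^ 2) ∧
    Integrable (fun z => dirD 1 b z ^ 2) ∧ Integrable (fun z => dirD Complex.I a z ^ 2) ∧
    Integrable (fun z => dirD Complex.I b z ^ 2) := by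
  have ca := fun e => (dirD_contDiff h.smooth_re e).continuous
  have cb := fun e => (dirD_contDiff h.smooth_im e).continuous
  refine ⟨h.int_grad.mono' ((ca _).pow 2).aestronglyMeasurable (Eventually.of_forall fun z => ?_),
    h.int_grad.mono' ((cb _).pow 2).aestronglyMeasurable (Eventually.of_forall fun z => ?_),
    h.int_grad.mono' ((ca _).pow 2).aestronglyMeasurable (Eventually.of_forall fun z => ?_),
    h.int_grad.mono' ((cb _).pow 2).aestronglyMeasurable (Eventually.of_forall fun z => ?_)⟩ <;>
  · simp only [norm_pow, Real.norm_eq_abs, sq_abs]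
    unfold grad2
    nlinarith [sq_nonneg (dirD 1 a z), sq_nonneg (dirD 1 b z), sq_nonneg (dirD Complex.I a z),
      sq_nonneg (dirD Complex.I b z)]

lemma int_sq_add_abs {f g : ℂ → ℝ} (hf : Continuous f) (hg : Continuous g)
    (i : Integrable fun z => f z ^ 2) (j : Integrable fun z => g z ^ 2) (K : ℝ) :
    Integrable (fun z => (K * (|f z| + |g z|)) ^ 2) := by
  refine ((i.add j).const_mul (2 * K ^ 2)).mono' ?_ (Eventually.of_forall fun z => ?_)
  · exact ((continuous_const.mul (hf.abs.add hg.abs)).pow 2).aestronglyMeasurable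
  · simp only [norm_pow, Real.norm_eq_abs, sq_abs, Pi.add_apply]
    rw [mul_pow]
    nlinarith [sq_nonneg (|f z| - |g z|), sq_abs (f z), sq_abs (g z), sq_nonneg K,
      mul_nonneg (sq_nonneg K) (sq_nonneg (|f z| - |g z|))]

lemma abs_le (h : FinTW c a b) (z : ℂ) : |a z| ≤ 5 + c ∧ |b z| ≤ 5 + c := by
  have := h.sq_modulus_le z
  have hc := h.speed_pos
  constructor <;> refine abs_le_of_sq_le_sq ?_ (by linarith) <;>
    nlinarith [sq_nonneg (a z), sq_nonneg (b z)]

/-- Pohozaev identity in inequality form: `c p ≤ E`. -/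
lemma speed_mul_le (h : FinTW c a b) :
    c * (1 / 2 * ∫ z, momDens a b z) ≤ 1 / 2 * (∫ z, grad2 a b z) + 1 / 4 * ∫ z, pot a b z := by
  obtain ⟨i1, i2, i3, i4⟩ := h.int_sq
  have ha := h.smooth_re
  have hb := h.smooth_im
  have da := smooth_differentiable ha
  have db := smooth_differentiable hb
  have sa := fun e => dirD_contDiff ha e
  have sb := fun e => dirD_contDiff hb e
  have da' := fun e => smooth_differentiable (sa e)
  have db' := fun e => smooth_differentiable (sb e)
  let A : ℂ → ℝ := fun z => (1 / 2) * (dirD 1 a z * dirD 1 a z + dirD 1 b z * dirD 1 b z)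
    - (1 / 2) * (dirD Complex.I a z * dirD Complex.I a z + dirD Complex.I b z * dirD Complex.I b z)
    - (1 / 4) * ((1 - (a z * a z + b z * b z)) * (1 - (a z * a z + b z * b z)))
    + (c / 2) * (dirD Complex.I b z - (a z * dirD Complex.I b z - b z * dirD Complex.I a z))
  let B : ℂ → ℝ := fun z => dirD 1 a z * dirD Complex.I a z + dirD 1 b z * dirD Complex.I b z
    - (c / 2) * (dirD 1 b z - (a z * dirD 1 b z - b z * dirD 1 a z))
  have sA : ContDiff ℝ (⊤ : ℕ∞) A :=
    (((contDiff_const.mul (((sa _).mul (sa _)).add ((sb _).mul (sb _)))).sub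
      (contDiff_const.mul (((sa _).mul (sa _)).add ((sb _).mul (sb _))))).sub
      (contDiff_const.mul ((contDiff_const.sub ((ha.mul ha).add (hb.mul hb))).mul
        (contDiff_const.sub ((ha.mul ha).add (hb.mul hb)))))).add
      (contDiff_const.mul ((sb _).sub ((ha.mul (sb _)).sub (hb.mul (sa _)))))
  have sB : ContDiff ℝ (⊤ : ℕ∞) B :=
    (((sa _).mul (sa _)).add ((sb _).mul (sb _))).sub
      (contDiff_const.mul ((sb _).sub ((ha.mul (sb _)).sub (hb.mul (sa _)))))
  have eA : A = fun z => (1 / 2) * (dirD 1 a z ^ 2 + dirD 1 b z ^ 2)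
      - (1 / 2) * (dirD Complex.I a z ^ 2 + dirD Complex.I b z ^ 2) - (1 / 4) * pot a b z
      + (c / 2) * momDens a b z := by
    funext z; simp only [A, pot, momDens]; ring
  have j1 : Integrable (fun z => (1 / 2) * (dirD 1 a z ^ 2 + dirD 1 b z ^ 2)) := (i1.add i2).const_mul _
  have j2 : Integrable (fun z => (1 / 2) * (dirD Complex.I a z ^ 2 + dirD Complex.I b z ^ 2)) :=
    (i3.add i4).const_mul _
  have j3 := h.int_pot.const_mul (1 / 4)
  have j4 := h.int_mom.const_mul (c / 2)
  have j5 : Integrable (fun z => (1 / 2) * (dirD 1 a z ^ 2 + dirD 1 b z ^ 2)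
      - (1 / 2) * (dirD Complex.I a z ^ 2 + dirD Complex.I b z ^ 2)) := j1.sub j2
  have j6 : Integrable (fun z => (1 / 2) * (dirD 1 a z ^ 2 + dirD 1 b z ^ 2)
      - (1 / 2) * (dirD Complex.I a z ^ 2 + dirD Complex.I b z ^ 2) - (1 / 4) * pot a b z) :=
    j5.sub j3
  have iA : Integrable A := by rw [eA]; exact j6.add j4
  have hD : ∀ z, dirD 1 A z + dirD Complex.I B z = 0 := by
    intro z
    have d1 : Differentiable ℝ (fun z => dirD 1 a z * dirD 1 a z + dirD 1 b z * dirD 1 b z) :=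
      ((da' _).fun_mul (da' _)).fun_add ((db' _).fun_mul (db' _))
    have d2 : Differentiable ℝ (fun z => dirD Complex.I a z * dirD Complex.I a z
      + dirD Complex.I b z * dirD Complex.I b z) :=
      ((da' _).fun_mul (da' _)).fun_add ((db' _).fun_mul (db' _))
    have d3 : Differentiable ℝ (fun z => a z * a z + b z * b z) :=
      (da.fun_mul da).fun_add (db.fun_mul db)
    have d4 : Differentiable ℝ (fun z => 1 - (a z * a z + b z * b z)) := d3.const_sub 1
    have d5 : Differentiable ℝ (fun z => (1 - (a z * a z + b z * b z)) * (1 - (a z * a z + b z * b z))) :=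
      d4.fun_mul d4
    have d6 : ∀ e, Differentiable ℝ (fun z => a z * dirD e b z - b z * dirD e a z) := fun e =>
      (da.fun_mul (db' _)).fun_sub (db.fun_mul (da' _))
    have d7 : ∀ e, Differentiable ℝ (fun z => dirD e b z - (a z * dirD e b z - b z * dirD e a z)) :=
      fun e => (db' _).fun_sub (d6 e)
    have d8 : Differentiable ℝ (fun z => dirD 1 a z * dirD Complex.I a z + dirD 1 b z * dirD Complex.I b z) :=
      ((da' _).fun_mul (da' _)).fun_add ((db' _).fun_mul (db' _))
    have c3 : ∀ e, dirD e (fun z => 1 - (a z * a z + b z * b z))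
        = fun z => - (2 * (a z * dirD e a z + b z * dirD e b z)) := by
      intro e
      rw [dirD_sub (differentiable_const 1) d3, dirD_const, dirD_add (da.fun_mul da) (db.fun_mul db),
        dirD_mul da da, dirD_mul db db]
      funext z; ring
    have c7 : ∀ e e', dirD e (fun z => dirD e' b z - (a z * dirD e' b z - b z * dirD e' a z))
        = fun z => dirD e (dirD e' b) z - ((a z * dirD e (dirD e' b) z + dirD e a z * dirD e' b z)
          - (b z * dirD e (dirD e' a) z + dirD e b z * dirD e' a z)) := by
      intro e e'
      rw [dirD_sub (db' _) (d6 e'), dirD_sub (da.fun_mul (db' _)) (db.fun_mul (da' _)),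
        dirD_mul da (db' _), dirD_mul db (da' _)]
    have c1 : ∀ e e', dirD e (fun z => dirD e' a z * dirD e' a z + dirD e' b z * dirD e' b z)
        = fun z => 2 * (dirD e' a z * dirD e (dirD e' a) z + dirD e' b z * dirD e (dirD e' b) z) := by
      intro e e'
      rw [dirD_add ((da' _).fun_mul (da' _)) ((db' _).fun_mul (db' _)), dirD_mul (da' _) (da' _),
        dirD_mul (db' _) (db' _)]
      funext z; ring
    have hA1 := dirD_add (((d1.const_mul (1 / 2)).fun_sub (d2.const_mul (1 / 2))).fun_sub
      (d5.const_mul (1 / 4))) ((d7 Complex.I).const_mul (c / 2)) 1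
    have hB1 := dirD_sub d8 ((d7 1).const_mul (c / 2)) Complex.I
    rw [dirD_sub ((d1.const_mul (1 / 2)).fun_sub (d2.const_mul (1 / 2))) (d5.const_mul (1 / 4)),
      dirD_sub (d1.const_mul (1 / 2)) (d2.const_mul (1 / 2)), dirD_const_mul d1, dirD_const_mul d2,
      dirD_const_mul d5, dirD_const_mul (d7 _), c1, c1, dirD_mul d4 d4, c3, c7] at hA1
    rw [dirD_const_mul (d7 _), c7, dirD_add ((da' _).fun_mul (da' _)) ((db' _).fun_mul (db' _)),
      dirD_mul (da' _) (da' _), dirD_mul (db' _) (db' _)] at hB1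
    simp only [A, B]
    rw [hA1, hB1]
    have e1 := h.eq_re z
    have e2 := h.eq_im z
    simp only [lapR] at e1 e2
    beta_reduce
    rw [dirD_symm ha Complex.I 1, dirD_symm hb Complex.I 1]
    linear_combination dirD 1 a z * e1 + dirD 1 b z * e2
  have key := integral_eq_neg_integral_re_mul_divergence (A := A) (B := B)
    (Lf := grad2 a b) (Mf := fun z => (c / 2 * (6 + c)) * (|dirD 1 a z| + |dirD 1 b z|))
    (sA.of_le (by exact_mod_cast le_top)) (sB.of_le (by exact_mod_cast le_top)) iA h.int_grad
    (int_sq_add_abs (sa 1).continuous (sb 1).continuous i1 i2 _) ?_ (ρ := 0) (fun z _ => hD z)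
  · simp only [hD, mul_zero, integral_zero, neg_zero] at key
    rw [eA] at key
    have k1 : ∫ z, (((1 / 2) * (dirD 1 a z ^ 2 + dirD 1 b z ^ 2)
      - (1 / 2) * (dirD Complex.I a z ^ 2 + dirD Complex.I b z ^ 2)) - (1 / 4) * pot a b z
      + (c / 2) * momDens a b z) = ((∫ z, (1 / 2) * (dirD 1 a z ^ 2 + dirD 1 b z ^ 2))
      - ∫ z, (1 / 2) * (dirD Complex.I a z ^ 2 + dirD Complex.I b z ^ 2)) - (∫ z, (1 / 4) * pot a b z)
      + ∫ z, (c / 2) * momDens a b z := by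
      rw [← integral_sub j1 j2, ← integral_sub j5 j3, ← integral_add j6 j4]
    rw [k1] at key
    have k2 : ∫ z, grad2 a b z = 2 * (∫ z, (1 / 2) * (dirD 1 a z ^ 2 + dirD 1 b z ^ 2))
        + 2 * ∫ z, (1 / 2) * (dirD Complex.I a z ^ 2 + dirD Complex.I b z ^ 2) := by
      rw [← integral_const_mul, ← integral_const_mul, ← integral_add (j1.const_mul 2) (j2.const_mul 2)]
      congr 1; funext z; unfold grad2; ring
    have k3 : 0 ≤ ∫ z, (1 / 2) * (dirD 1 a z ^ 2 + dirD 1 b z ^ 2) :=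
      integral_nonneg fun z => by positivity
    rw [integral_const_mul (1 / 4), integral_const_mul (c / 2)] at key
    rw [k2]
    linarith
  · intro z
    simp only [B]
    obtain ⟨b1, b2⟩ := h.abs_le z
    have hc := h.speed_pos
    have t1 : |dirD 1 a z * dirD Complex.I a z + dirD 1 b z * dirD Complex.I b z| ≤ grad2 a b z := by
      unfold grad2
      rw [_root_.abs_le]
      constructor <;> nlinarith [sq_nonneg (dirD 1 a z - dirD Complex.I a z),
        sq_nonneg (dirD 1 b z - dirD Complex.I b z), sq_nonneg (dirD 1 a z + dirD Complex.I a z),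
        sq_nonneg (dirD 1 b z + dirD Complex.I b z)]
    have t2 : |dirD 1 b z - (a z * dirD 1 b z - b z * dirD 1 a z)|
        ≤ (6 + c) * (|dirD 1 a z| + |dirD 1 b z|) := by
      have s1 := abs_sub (dirD 1 b z) (a z * dirD 1 b z - b z * dirD 1 a z)
      have s2 := abs_sub (a z * dirD 1 b z) (b z * dirD 1 a z)
      rw [abs_mul, abs_mul] at s2
      have s3 := mul_le_mul_of_nonneg_right b1 (abs_nonneg (dirD 1 b z))
      have s4 := mul_le_mul_of_nonneg_right b2 (abs_nonneg (dirD 1 a z))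
      nlinarith [abs_nonneg (dirD 1 a z)]
    refine (abs_sub _ _).trans (add_le_add t1 ?_)
    rw [abs_mul, abs_of_pos (by linarith : 0 < c / 2), mul_assoc]
    exact mul_le_mul_of_nonneg_left t2 (by linarith)

/-- Control of the momentum by the energy and the first moment of the weighted Jacobian. -/
lemma mom_le (h : FinTW c a b) (hc : c ≤ 1) {g : ℝ → ℝ} {K : ℝ} (hg : Regularizer g K) {ρ : ℝ}
    (hρ : ∀ z : ℂ, ρ < ‖z‖ → 1 / 4 < a z * a z + b z * b z) :
    1 / 2 * (∫ z, momDens a b z) ≤ (24 + 12 * K) * ((∫ z, grad2 a b z) + ∫ z, pot a b z)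
      + ∫ z : ℂ, z.re * wJac g a b 1 Complex.I z := by
  obtain ⟨i1, i2, i3, i4⟩ := h.int_sq
  have ha := h.smooth_re
  have hb := h.smooth_im
  have sa := fun e => dirD_contDiff ha e
  have sb := fun e => dirD_contDiff hb e
  have hK := hg.nonneg
  let A : ℂ → ℝ := fun z => dirD Complex.I b z - current g a b Complex.I z
  let B : ℂ → ℝ := fun z => current g a b 1 z - dirD 1 b z
  have sA : ContDiff ℝ (⊤ : ℕ∞) A := (sb _).sub (current_contDiff hg.smooth ha hb _)
  have sB : ContDiff ℝ (⊤ : ℕ∞) B := (current_contDiff hg.smooth ha hb _).sub (sb _)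
  have bj : ∀ z e, |a z * dirD e b z - b z * dirD e a z| ≤ 6 * (|dirD e a z| + |dirD e b z|) := by
    intro z e
    obtain ⟨b1, b2⟩ := h.abs_le z
    have s2 := abs_sub (a z * dirD e b z) (b z * dirD e a z)
    rw [abs_mul, abs_mul] at s2
    have s3 := mul_le_mul_of_nonneg_right b1 (abs_nonneg (dirD e b z))
    have s4 := mul_le_mul_of_nonneg_right b2 (abs_nonneg (dirD e a z))
    nlinarith [abs_nonneg (dirD e a z), abs_nonneg (dirD e b z)]
  have bdiff : ∀ z, |momDens a b z - A z| ≤ (24 + 12 * K) * (grad2 a b z + pot a b z) := by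
    intro z
    have e : momDens a b z - A z = (g (a z * a z + b z * b z) - 1)
        * (a z * dirD Complex.I b z - b z * dirD Complex.I a z) := by
      simp only [A, momDens, current]; ring
    rw [e, abs_mul]
    set s := a z * a z + b z * b z with hs
    have h1 : |g s - 1| ≤ (4 + 2 * K) * |1 - s| := by
      by_cases h4 : 1 / 4 ≤ s
      · rw [hg.eq_inv s h4]
        have : 1 / s - 1 = (1 / s) * (1 - s) := by field_simp
        rw [this, abs_mul]
        refine mul_le_mul_of_nonneg_right ?_ (abs_nonneg _)
        rw [abs_of_pos (by positivity)]
        have : 1 / s ≤ 4 := by rw [div_le_iff₀ (by linarith)]; linarith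
        linarith
      · push Not at h4
        have t1 := (abs_sub (g s) 1).trans (add_le_add_left (hg.bound s) _)
        rw [abs_one] at t1
        have t2 : 3 / 4 ≤ |1 - s| := by rw [abs_of_pos (by linarith)]; linarith
        nlinarith
    have h2 := bj z Complex.I
    calc _ ≤ ((4 + 2 * K) * |1 - s|) * (6 * (|dirD Complex.I a z| + |dirD Complex.I b z|)) :=
          mul_le_mul h1 h2 (abs_nonneg _) (by positivity)
      _ = (24 + 12 * K) * (|1 - s| * (|dirD Complex.I a z| + |dirD Complex.I b z|)) := by ring
      _ ≤ _ := by
          refine mul_le_mul_of_nonneg_left ?_ (by linarith)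
          have e2 : pot a b z = |1 - s| ^ 2 := by rw [sq_abs, hs]; unfold pot; ring
          rw [e2]
          unfold grad2
          nlinarith [sq_abs (dirD Complex.I a z), sq_abs (dirD Complex.I b z),
            sq_nonneg (|1 - s| - 2 * |dirD Complex.I a z|), sq_nonneg (|1 - s| - 2 * |dirD Complex.I b z|),
            sq_nonneg (|1 - s| - |dirD Complex.I a z|), sq_nonneg (|1 - s| - |dirD Complex.I b z|),
            sq_nonneg (dirD 1 a z), sq_nonneg (dirD 1 b z), sq_nonneg (|1 - s|)]
  have iG : Integrable (fun z => (24 + 12 * K) * (grad2 a b z + pot a b z)) :=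
    (h.int_grad.add h.int_pot).const_mul _
  have cmom : Continuous (momDens a b) := by
    have := ha.continuous
    have := hb.continuous
    have := fun e => (sa e).continuous
    have := fun e => (sb e).continuous
    unfold momDens; fun_prop
  have idiff : Integrable (fun z => momDens a b z - A z) :=
    iG.mono' (cmom.sub sA.continuous).aestronglyMeasurable (Eventually.of_forall bdiff)
  have iA : Integrable A := by
    have := h.int_mom.sub idiff
    refine this.congr (Eventually.of_forall fun z => ?_)
    simp
  have hD : ∀ z, dirD 1 A z + dirD Complex.I B z = - 2 * wJac g a b 1 Complex.I z := by
    intro z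
    have d1 := smooth_differentiable (sb Complex.I)
    have d2 := smooth_differentiable (sb 1)
    have d3 := fun e => smooth_differentiable (current_contDiff hg.smooth ha hb e)
    have := curl_current hg.smooth ha hb 1 Complex.I z
    simp only [A, B]
    rw [dirD_sub d1 (d3 _), dirD_sub (d3 _) d2]
    beta_reduce
    rw [dirD_symm hb 1 Complex.I]
    linarith
  have key := integral_eq_neg_integral_re_mul_divergence (A := A) (B := B)
    (Lf := fun _ => 0) (Mf := fun z => (6 * K + 1) * (|dirD 1 a z| + |dirD 1 b z|))
    (sA.of_le (by exact_mod_cast le_top)) (sB.of_le (by exact_mod_cast le_top)) iA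
    (integrable_zero _ _ _)
    (int_sq_add_abs (sa 1).continuous (sb 1).continuous i1 i2 _) ?_ (ρ := ρ) ?_
  · have e : ∫ z : ℂ, z.re * (dirD 1 A z + dirD Complex.I B z)
        = -2 * ∫ z : ℂ, z.re * wJac g a b 1 Complex.I z := by
      rw [← integral_const_mul]
      congr 1; funext z; rw [hD]; ring
    rw [e] at key
    have k1 : ∫ z, momDens a b z = (∫ z, (momDens a b z - A z)) + ∫ z, A z := by
      rw [← integral_add idiff iA]; simp
    have k2 : ∫ z, (momDens a b z - A z) ≤ (24 + 12 * K) * ((∫ z, grad2 a b z) + ∫ z, pot a b z) := by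
      rw [← integral_add h.int_grad h.int_pot, ← integral_const_mul]
      exact integral_mono idiff iG fun z => (le_abs_self _).trans (bdiff z)
    have k3 : 0 ≤ (24 + 12 * K) * ((∫ z, grad2 a b z) + ∫ z, pot a b z) := by
      have q1 : 0 ≤ ∫ z, grad2 a b z := integral_nonneg fun z => by unfold grad2; positivity
      have q2 : 0 ≤ ∫ z, pot a b z := integral_nonneg fun z => by unfold pot; positivity
      positivity
    rw [k1]
    linarith
  · intro z
    simp only [B, zero_add]
    refine (abs_sub _ _).trans ?_
    have : |current g a b 1 z| ≤ K * (6 * (|dirD 1 a z| + |dirD 1 b z|)) := by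
      unfold current
      rw [abs_mul]
      exact mul_le_mul (hg.bound _) (bj z 1) (abs_nonneg _) hK
    nlinarith [abs_nonneg (dirD 1 a z)]
  · intro z hz
    rw [hD, wJac, hg.deriv_eq _ (hρ z hz)]
    simp

end FinTW

/-- Polar coordinates centred at `c`. -/
def polarMap (c : ℂ) (p : ℝ × ℝ) : ℂ :=
  c + ((p.1 * Real.cos p.2) • (1 : ℂ) + (p.1 * Real.sin p.2) • Complex.I)

lemma polarMap_contDiff (c : ℂ) : ContDiff ℝ (⊤ : ℕ∞) (polarMap c) := by
  have hc : ContDiff ℝ (⊤ : ℕ∞) (fun p : ℝ × ℝ => Real.cos p.2) := Real.contDiff_cos.comp contDiff_snd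
  have hs : ContDiff ℝ (⊤ : ℕ∞) (fun p : ℝ × ℝ => Real.sin p.2) := Real.contDiff_sin.comp contDiff_snd
  exact contDiff_const.add (((contDiff_fst.mul hc).smul contDiff_const).add
    ((contDiff_fst.mul hs).smul contDiff_const))

lemma polarMap_eq (c : ℂ) (p : ℝ × ℝ) : polarMap c p = c + Complex.polarCoord.symm p := by
  rw [Complex.polarCoord_symm_apply]
  apply Complex.ext <;> simp [polarMap]

lemma norm_polarMap_sub (c : ℂ) (p : ℝ × ℝ) : ‖polarMap c p - c‖ = |p.1| := by
  rw [polarMap_eq, add_sub_cancel_left, Complex.norm_polarCoord_symm]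

lemma dirD_polarMap {f : ℂ → ℝ} (hf : Differentiable ℝ f) (c : ℂ) (p e : ℝ × ℝ) :
    dirD e (fun p => f (polarMap c p)) p
      = (e.1 * Real.cos p.2 - e.2 * (p.1 * Real.sin p.2)) * dirD 1 f (polarMap c p)
        + (e.1 * Real.sin p.2 + e.2 * (p.1 * Real.cos p.2)) * dirD Complex.I f (polarMap c p) := by
  have h1 : HasFDerivAt (fun p : ℝ × ℝ => p.1) (ContinuousLinearMap.fst ℝ ℝ ℝ) p := hasFDerivAt_fst
  have h2 : HasFDerivAt (fun p : ℝ × ℝ => p.2) (ContinuousLinearMap.snd ℝ ℝ ℝ) p := hasFDerivAt_snd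
  have hP := (((h1.mul h2.cos).smul_const (1 : ℂ)).add ((h1.mul h2.sin).smul_const Complex.I)).const_add c
  have h3 := (hf (polarMap c p)).hasFDerivAt.comp p hP
  simp only [dirD]
  rw [show (fun p => f (polarMap c p)) = f ∘ (polarMap c) from rfl]
  have h4 : fderiv ℝ (f ∘ polarMap c) p = _ := h3.fderiv
  rw [h4]
  simp only [ContinuousLinearMap.comp_apply, add_apply, map_add,
    ContinuousLinearMap.smulRight_apply, map_smul, smul_apply, smul_eq_mul,
    ContinuousLinearMap.coe_fst', ContinuousLinearMap.coe_snd']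
  ring

lemma integral_polarMap {F : ℂ → ℝ} (hF : Continuous F) (c : ℂ) {r₁ r₂ : ℝ} (h0 : 0 ≤ r₁)
    (h12 : r₁ ≤ r₂) {S : Set ℂ} (hS : MeasurableSet S)
    (hSr : ∀ z, z ≠ c → (z ∈ S ↔ ‖z - c‖ ∈ Set.Ioc r₁ r₂)) :
    ∫ z in S, F z = ∫ r in r₁..r₂, ∫ θ in (-Real.pi)..Real.pi, r * F (polarMap c (r, θ)) := by
  have hpi : -Real.pi ≤ Real.pi := by linarith [Real.pi_pos]
  have cP : Continuous fun p : ℝ × ℝ => p.1 * F (polarMap c p) :=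
    continuous_fst.mul (hF.comp (polarMap_contDiff c).continuous)
  have sub : Set.Ioc r₁ r₂ ×ˢ Set.Ioo (-Real.pi) Real.pi ⊆ polarCoord.target := by
    intro p hp
    exact ⟨lt_of_le_of_lt h0 hp.1.1, hp.2⟩
  have mT : MeasurableSet (Set.Ioc r₁ r₂ ×ˢ Set.Ioo (-Real.pi) Real.pi) :=
    measurableSet_Ioc.prod measurableSet_Ioo
  calc ∫ z in S, F z = ∫ z, S.indicator F z := (integral_indicator hS).symm
    _ = ∫ w, S.indicator F (c + w) := (integral_add_left_eq_self _ c).symm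
    _ = ∫ p in polarCoord.target, p.1 • S.indicator F (c + Complex.polarCoord.symm p) :=
        (Complex.integral_comp_polarCoord_symm _).symm
    _ = ∫ p in polarCoord.target, (Set.Ioc r₁ r₂ ×ˢ Set.Ioo (-Real.pi) Real.pi).indicator
          (fun p => p.1 * F (polarMap c p)) p := by
        refine setIntegral_congr_fun polarCoord.open_target.measurableSet fun p hp => ?_
        have hp1 : 0 < p.1 := hp.1
        have hn := norm_polarMap_sub c p
        rw [abs_of_pos hp1] at hn
        have hne : polarMap c p ≠ c := by
          intro h; rw [h, sub_self, norm_zero] at hn; linarith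
        have := hSr _ hne
        rw [hn] at this
        rw [← polarMap_eq]
        by_cases hm : p.1 ∈ Set.Ioc r₁ r₂
        · rw [Set.indicator_of_mem (this.2 hm), Set.indicator_of_mem
            (show p ∈ Set.Ioc r₁ r₂ ×ˢ Set.Ioo (-Real.pi) Real.pi from ⟨hm, hp.2⟩), smul_eq_mul]
        · rw [Set.indicator_of_notMem (fun h => hm (this.1 h)),
            Set.indicator_of_notMem (fun h => hm h.1), smul_zero]
    _ = ∫ p in Set.Ioc r₁ r₂ ×ˢ Set.Ioo (-Real.pi) Real.pi, p.1 * F (polarMap c p) := by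
        rw [setIntegral_indicator mT, Set.inter_eq_self_of_subset_right sub]
    _ = ∫ r in Set.Ioc r₁ r₂, ∫ θ in Set.Ioo (-Real.pi) Real.pi, r * F (polarMap c (r, θ)) := by
        rw [Measure.volume_eq_prod, setIntegral_prod]
        refine IntegrableOn.mono_set (t := Set.Icc r₁ r₂ ×ˢ Set.Icc (-Real.pi) Real.pi) ?_
          (Set.prod_mono Set.Ioc_subset_Icc_self Set.Ioo_subset_Icc_self)
        exact cP.continuousOn.integrableOn_compact (isCompact_Icc.prod isCompact_Icc)
    _ = _ := by
        rw [intervalIntegral.integral_of_le h12]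
        simp_rw [intervalIntegral.integral_of_le hpi, integral_Ioc_eq_integral_Ioo]

section Circulation
variable {g : ℝ → ℝ} {K : ℝ} {a b : ℂ → ℝ}

/-- Angular component of the weighted current in polar coordinates centred at `c`. -/
def angCurrent (g : ℝ → ℝ) (a b : ℂ → ℝ) (c : ℂ) : ℝ × ℝ → ℝ :=
  current g (fun p => a (polarMap c p)) (fun p => b (polarMap c p)) (0, 1)

/-- Circulation of the weighted current along a circle. -/
def circulation (g : ℝ → ℝ) (a b : ℂ → ℝ) (c : ℂ) (r : ℝ) : ℝ :=
  ∫ θ in (-Real.pi)..Real.pi, angCurrent g a b c (r, θ)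

lemma contDiff_comp_polarMap (ha : ContDiff ℝ (⊤ : ℕ∞) a) (c : ℂ) :
    ContDiff ℝ (⊤ : ℕ∞) fun p => a (polarMap c p) := ha.comp (polarMap_contDiff c)

lemma polarMap_pi (c : ℂ) (r : ℝ) : polarMap c (r, Real.pi) = polarMap c (r, -Real.pi) := by
  simp [polarMap]

lemma angCurrent_eq (ha : ContDiff ℝ (⊤ : ℕ∞) a) (hb : ContDiff ℝ (⊤ : ℕ∞) b) (c : ℂ) (p : ℝ × ℝ) :
    angCurrent g a b c p = p.1 * (Real.cos p.2 * current g a b Complex.I (polarMap c p)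
      - Real.sin p.2 * current g a b 1 (polarMap c p)) := by
  simp only [angCurrent, current]
  rw [dirD_polarMap (smooth_differentiable ha), dirD_polarMap (smooth_differentiable hb)]
  simp only
  ring

/-- Green's formula on a disc, in polar coordinates. -/
lemma integral_closedBall_wJac (hg : ContDiff ℝ (⊤ : ℕ∞) g) (ha : ContDiff ℝ (⊤ : ℕ∞) a)
    (hb : ContDiff ℝ (⊤ : ℕ∞) b) (c : ℂ) {R : ℝ} (hR : 0 ≤ R) :
    2 * ∫ z in closedBall c R, wJac g a b 1 Complex.I z = circulation g a b c R := by
  have ha' := contDiff_comp_polarMap ha c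
  have hb' := contDiff_comp_polarMap hb c
  set A : ℝ × ℝ → ℝ := fun p => a (polarMap c p) with hA
  set B : ℝ × ℝ → ℝ := fun p => b (polarMap c p) with hB
  have s1 := current_contDiff hg ha' hb' (0, 1)
  have s2 := (current_contDiff hg ha' hb' (1, 0)).neg
  have d1 := smooth_differentiable s1
  have d2 := smooth_differentiable s2
  have c1 : Continuous fun p => fderiv ℝ (current g A B (0, 1)) p (1, 0) :=
    (s1.continuous_fderiv (by simp)).clm_apply continuous_const
  have c2 : Continuous fun p => fderiv ℝ (fun p => - current g A B (1, 0) p) p (0, 1) :=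
    (s2.continuous_fderiv (by simp)).clm_apply continuous_const
  have green := integral2_divergence_prod_of_hasFDerivAt
    (current g A B (0, 1)) (fun p => - current g A B (1, 0) p)
    (fun p => fderiv ℝ (current g A B (0, 1)) p) (fun p => fderiv ℝ (fun p => - current g A B (1, 0) p) p)
    0 (-Real.pi) R Real.pi s1.continuous.continuousOn s2.continuous.continuousOn
    (fun p _ => (d1 p).hasFDerivAt) (fun p _ => (d2 p).hasFDerivAt)
    ((c1.add c2).continuousOn.integrableOn_compact (isCompact_uIcc.prod isCompact_uIcc))
  have e1 : ∀ p : ℝ × ℝ, fderiv ℝ (current g A B (0, 1)) p (1, 0)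
      + fderiv ℝ (fun p => - current g A B (1, 0) p) p (0, 1)
      = 2 * (p.1 * wJac g a b 1 Complex.I (polarMap c p)) := by
    intro p
    have h := curl_current hg ha' hb' (1, 0) (0, 1) p
    have hneg : fderiv ℝ (fun p => - current g A B (1, 0) p) p (0, 1)
        = - dirD (0, 1) (current g A B (1, 0)) p := by
      simp only [dirD]; rw [fderiv_fun_neg]; rfl
    rw [hneg, ← sub_eq_add_neg]
    refine Eq.trans h ?_
    simp only [wJac]
    rw [dirD_polarMap (smooth_differentiable ha), dirD_polarMap (smooth_differentiable ha),
      dirD_polarMap (smooth_differentiable hb), dirD_polarMap (smooth_differentiable hb)]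
    simp only
    linear_combination (2 * (g (a (polarMap c p) * a (polarMap c p) + b (polarMap c p) * b (polarMap c p)) +
          (a (polarMap c p) * a (polarMap c p) + b (polarMap c p) * b (polarMap c p)) *
            deriv g (a (polarMap c p) * a (polarMap c p) + b (polarMap c p) * b (polarMap c p))) *
        (p.1 * (dirD 1 a (polarMap c p) * dirD Complex.I b (polarMap c p)
          - dirD Complex.I a (polarMap c p) * dirD 1 b (polarMap c p)))) * Real.cos_sq_add_sin_sq p.2
  have e2 : ∀ θ, current g A B (0, 1) (0, θ) = 0 := by
    intro θ
    have := angCurrent_eq (g := g) ha hb c (0, θ)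
    simpa [angCurrent] using this
  have e3 : ∀ r, current g A B (1, 0) (r, Real.pi) = current g A B (1, 0) (r, -Real.pi) := by
    intro r
    simp only [current, hA, hB]
    rw [dirD_polarMap (smooth_differentiable ha), dirD_polarMap (smooth_differentiable hb),
      dirD_polarMap (smooth_differentiable ha), dirD_polarMap (smooth_differentiable hb)]
    simp [polarMap_pi]
  simp only [e1] at green
  simp only [e2, e3, intervalIntegral.integral_zero, sub_self, zero_add, sub_zero] at green
  rw [integral_polarMap (wJac_continuous hg ha hb 1 Complex.I) c le_rfl hR measurableSet_closedBall
    (fun z hz => by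
      have : 0 < ‖z - c‖ := norm_pos_iff.2 (sub_ne_zero.2 hz)
      simp [dist_eq_norm, this])]
  rw [circulation, angCurrent, ← green, ← intervalIntegral.integral_const_mul]
  congr 1
  funext r
  rw [← intervalIntegral.integral_const_mul]

/-- The circulation along a circle avoiding small values of the modulus is quantized. -/
lemma circulation_quantized (hg : Regularizer g K) (ha : ContDiff ℝ (⊤ : ℕ∞) a)
    (hb : ContDiff ℝ (⊤ : ℕ∞) b) (c : ℂ) {r : ℝ} (hr : 0 ≤ r)
    (hgood : ∀ z : ℂ, ‖z - c‖ = r → 1 / 4 < a z * a z + b z * b z) :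
    ∃ k : ℤ, circulation g a b c r = 2 * Real.pi * k := by
  let A : ℝ → ℝ := fun θ => a (polarMap c (r, θ))
  let B : ℝ → ℝ := fun θ => b (polarMap c (r, θ))
  have hpt : ∀ θ, 1 / 4 < A θ * A θ + B θ * B θ := fun θ =>
    hgood _ (by rw [norm_polarMap_sub, abs_of_nonneg hr])
  have hd : ∀ {f : ℂ → ℝ}, ContDiff ℝ (⊤ : ℕ∞) f → ∀ θ : ℝ, HasDerivAt (fun θ => f (polarMap c (r, θ)))
      (dirD (0, 1) (fun p => f (polarMap c p)) (r, θ)) θ := by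
    intro f hf θ
    have := hasDerivAt_line (smooth_differentiable (contDiff_comp_polarMap hf c)) (r, 0) (0, 1) θ
    simpa using this
  let A' : ℝ → ℝ := fun θ => dirD (0, 1) (fun p => a (polarMap c p)) (r, θ)
  let B' : ℝ → ℝ := fun θ => dirD (0, 1) (fun p => b (polarMap c p)) (r, θ)
  have hcont : ∀ {f : ℂ → ℝ}, ContDiff ℝ (⊤ : ℕ∞) f →
      Continuous fun θ : ℝ => dirD (0, 1) (fun p => f (polarMap c p)) (r, θ) := by
    intro f hf
    exact (dirD_contDiff (contDiff_comp_polarMap hf c) (0, 1)).continuous.comp (by fun_prop)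
  let γ : ℝ → ℂ := fun θ => (A θ : ℂ) + (B θ : ℂ) * Complex.I
  let γ' : ℝ → ℂ := fun θ => (A' θ : ℂ) + (B' θ : ℂ) * Complex.I
  have hγ : ∀ θ, HasDerivAt γ (γ' θ) θ := fun θ =>
    (hd ha θ).ofReal_comp.add ((hd hb θ).ofReal_comp.mul_const _)
  have hγ0 : ∀ θ, γ θ ≠ 0 := by
    intro θ h0
    have h1 := congrArg Complex.re h0
    have h2 := congrArg Complex.im h0
    simp [γ] at h1 h2
    have := hpt θ
    rw [h1, h2] at this
    norm_num at this
  have cγ : Continuous γ := continuous_iff_continuousAt.2 fun θ => (hγ θ).continuousAt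
  have cγ' : Continuous γ' :=
    (Complex.continuous_ofReal.comp (hcont ha)).add
      ((Complex.continuous_ofReal.comp (hcont hb)).mul continuous_const)
  have cq : Continuous fun θ => γ' θ / γ θ := cγ'.div cγ hγ0
  let I : ℝ → ℂ := fun θ => ∫ t in (-Real.pi)..θ, γ' t / γ t
  have hI : ∀ θ, HasDerivAt I (γ' θ / γ θ) θ := fun θ =>
    intervalIntegral.integral_hasDerivAt_right (cq.intervalIntegrable _ _)
      (cq.stronglyMeasurableAtFilter _ _) cq.continuousAt
  have hH : ∀ θ, HasDerivAt (fun θ => γ θ * Complex.exp (-(I θ))) 0 θ := by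
    intro θ
    refine ((hγ θ).mul (hI θ).neg.cexp).congr_deriv ?_
    field_simp [hγ0 θ]
    simp
  have hconst := is_const_of_deriv_eq_zero (fun θ => (hH θ).differentiableAt)
    (fun θ => (hH θ).deriv) Real.pi (-Real.pi)
  have hper : γ Real.pi = γ (-Real.pi) := by simp only [γ, A, B, polarMap_pi]
  have hI0 : I (-Real.pi) = 0 := by simp [I]
  rw [hper, hI0] at hconst
  simp only [neg_zero, Complex.exp_zero, mul_one] at hconst
  have hexp : Complex.exp (-(I Real.pi)) = 1 := by
    have := hγ0 (-Real.pi)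
    field_simp at hconst
    exact hconst
  obtain ⟨k, hk⟩ := Complex.exp_eq_one_iff.1 hexp
  refine ⟨-k, ?_⟩
  have him : circulation g a b c r = (I Real.pi).im := by
    have := (Complex.imCLM.intervalIntegral_comp_comm (μ := volume) (cq.intervalIntegrable (-Real.pi) Real.pi))
    simp only [Complex.imCLM_apply] at this
    simp only [I]
    rw [← this, circulation]
    congr 1
    funext θ
    have hs := hpt θ
    simp only [angCurrent, current]
    rw [hg.eq_inv _ hs.le, Complex.div_im]
    have hn : Complex.normSq (γ θ) = A θ * A θ + B θ * B θ := by
      simp [γ, Complex.normSq_apply]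
    rw [hn]
    simp only [γ, γ', Complex.add_re, Complex.add_im, Complex.mul_re, Complex.mul_im, Complex.ofReal_re,
      Complex.ofReal_im, Complex.I_re, Complex.I_im]
    simp only [A, B, A', B']
    ring
  rw [him]
  have := congrArg Complex.im hk
  simp at this
  push_cast
  linarith

end Circulation

section AngularEnergy
variable {g : ℝ → ℝ} {K : ℝ} {a b : ℂ → ℝ}

/-- Density of the angular part of the energy, weighted by `g`, plus a fraction of the potential. -/
def angEnergy (g : ℝ → ℝ) (a b : ℂ → ℝ) (z : ℂ) : ℝ :=
  1 / 2 * (g (a z * a z + b z * b z) * ((a z * dirD 1 b z - b z * dirD 1 a z) ^ 2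
    + (a z * dirD Complex.I b z - b z * dirD Complex.I a z) ^ 2)) + 1 / 8 * pot a b z

lemma angEnergy_continuous (hg : Continuous g) (ha : ContDiff ℝ (⊤ : ℕ∞) a)
    (hb : ContDiff ℝ (⊤ : ℕ∞) b) : Continuous (angEnergy g a b) := by
  have := (dirD_contDiff ha 1).continuous
  have := (dirD_contDiff ha Complex.I).continuous
  have := (dirD_contDiff hb 1).continuous
  have := (dirD_contDiff hb Complex.I).continuous
  have := ha.continuous
  have := hb.continuous
  unfold angEnergy pot
  fun_prop

lemma angEnergy_nonneg (hg : Regularizer g K) (z : ℂ) : 0 ≤ angEnergy g a b z := by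
  have := (hg.nonneg_and_mul_le (a z * a z + b z * b z)
    (add_nonneg (mul_self_nonneg _) (mul_self_nonneg _))).1
  unfold angEnergy pot
  positivity

lemma le_mul_angEnergy (hg : Regularizer g K) (ha : ContDiff ℝ (⊤ : ℕ∞) a)
    (hb : ContDiff ℝ (⊤ : ℕ∞) b) (c : ℂ) {r θ ε : ℝ} (hε : ε ^ 2 = 1) (hr : 0 < r)
    (hgood : 1 / 4 < a (polarMap c (r, θ)) * a (polarMap c (r, θ))
      + b (polarMap c (r, θ)) * b (polarMap c (r, θ))) :
    ε * angCurrent g a b c (r, θ) / r - 1 / (2 * r) - 8 / r ^ 3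
      ≤ r * angEnergy g a b (polarMap c (r, θ)) := by
  rw [angCurrent_eq ha hb]
  set z := polarMap c (r, θ)
  simp only [angEnergy, current, pot]
  rw [hg.eq_inv _ hgood.le]
  set j1 := a z * dirD 1 b z - b z * dirD 1 a z
  set j2 := a z * dirD Complex.I b z - b z * dirD Complex.I a z
  rw [show a z ^ 2 + b z ^ 2 = a z * a z + b z * b z by ring]
  set s := a z * a z + b z * b z
  have hs : 0 < s := by linarith
  have cs := Real.cos_sq_add_sin_sq θ
  set C := Real.cos θ
  set S := Real.sin θ
  have h1 : (C * j2 - S * j1) ^ 2 ≤ j1 ^ 2 + j2 ^ 2 := by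
    have : (C * j2 - S * j1) ^ 2 + (C * j1 + S * j2) ^ 2 = (C ^ 2 + S ^ 2) * (j1 ^ 2 + j2 ^ 2) := by
      ring
    rw [cs, one_mul] at this
    nlinarith [sq_nonneg (C * j1 + S * j2)]
  set w := C * j2 - S * j1
  have e1 : ε * (r * (C * (1 / s * j2) - S * (1 / s * j1))) / r = ε * w / s := by
    simp only [w]; field_simp
  rw [e1]
  have h2 : ε * w / s - 1 / (2 * s * r) ≤ r * (1 / 2 * (1 / s * w ^ 2)) := by
    have : r * (1 / 2 * (1 / s * w ^ 2)) - (ε * w / s - 1 / (2 * s * r))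
        = (ε * r * w - 1) ^ 2 / (2 * s * r) - (ε ^ 2 - 1) * r * w ^ 2 / (2 * s) := by
      field_simp; ring
    rw [hε] at this
    have h0 : 0 ≤ (ε * r * w - 1) ^ 2 / (2 * s * r) := by positivity
    simp only [sub_self, zero_mul, zero_div, sub_zero] at this
    linarith
  have h3 : 1 / (2 * s * r) - 1 / (2 * r) ≤ 8 / r ^ 3 + r * (1 / 8 * (1 - s) ^ 2) := by
    have h4 : 1 / (2 * s * r) - 1 / (2 * r) ≤ 2 * |1 - s| / r := by
      rw [show 1 / (2 * s * r) - 1 / (2 * r) = ((1 - s) / (2 * s)) / r by field_simp]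
      gcongr
      rw [div_le_iff₀ (by positivity)]
      nlinarith [le_abs_self (1 - s), abs_nonneg (1 - s)]
    have h5 : 8 / r ^ 3 + r * (1 / 8 * (1 - s) ^ 2) - 2 * |1 - s| / r
        = (8 - r ^ 2 * |1 - s|) ^ 2 / (8 * r ^ 3) := by
      rw [← sq_abs (1 - s)]; field_simp; ring
    have h0 : 0 ≤ (8 - r ^ 2 * |1 - s|) ^ 2 / (8 * r ^ 3) := by positivity
    linarith
  have h6 : r * (1 / 2 * (1 / s * w ^ 2)) ≤ r * (1 / 2 * (1 / s * (j1 ^ 2 + j2 ^ 2))) := by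
    gcongr
  linarith

lemma integral_annulus_angEnergy_ge (hg : Regularizer g K) (ha : ContDiff ℝ (⊤ : ℕ∞) a)
    (hb : ContDiff ℝ (⊤ : ℕ∞) b) (c : ℂ) {r₁ r₂ : ℝ} (h1 : 0 < r₁) (h12 : r₁ < r₂)
    (hgood : ∀ z : ℂ, r₁ < ‖z - c‖ → ‖z - c‖ ≤ r₂ → 1 / 4 < a z * a z + b z * b z)
    (hne : ∫ z in closedBall c r₁, wJac g a b 1 Complex.I z ≠ 0) :
    Real.pi * (Real.log (r₂ / r₁) - 8 * (1 / r₁ ^ 2 - 1 / r₂ ^ 2))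
      ≤ ∫ z in ball c r₂ \ closedBall c r₁, angEnergy g a b z := by
  have hpi := Real.pi_pos
  have cE := angEnergy_continuous hg.smooth.continuous ha hb
  have hjac : ∀ r ∈ Set.Ioc r₁ r₂, circulation g a b c r
      = 2 * ∫ z in closedBall c r₁, wJac g a b 1 Complex.I z := by
    intro r hr
    rw [← integral_closedBall_wJac hg.smooth ha hb c (h1.trans hr.1).le]
    congr 1
    refine setIntegral_eq_of_subset_of_forall_sdiff_eq_zero measurableSet_closedBall
      (closedBall_subset_closedBall hr.1.le) fun z hz => ?_
    have := hgood z (by simpa [dist_eq_norm] using hz.2)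
      (le_trans (by simpa [dist_eq_norm] using hz.1) hr.2)
    simp only [wJac]
    rw [hg.deriv_eq _ this, zero_mul]
  set Γ := 2 * ∫ z in closedBall c r₁, wJac g a b 1 Complex.I z with hΓ
  have hΓ2 : 2 * Real.pi ≤ |Γ| := by
    obtain ⟨k, hk⟩ := circulation_quantized hg ha hb c (h1.trans h12).le
      (fun z hz => hgood z (by rw [hz]; exact h12) hz.le)
    rw [hjac r₂ ⟨h12, le_rfl⟩] at hk
    have hk0 : k ≠ 0 := by
      rintro rfl
      rw [hΓ] at hk
      simp only [Int.cast_zero, mul_zero, mul_eq_zero, OfNat.ofNat_ne_zero, false_or] at hk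
      exact hne hk
    have : (1 : ℝ) ≤ |(k : ℝ)| := by exact_mod_cast Int.one_le_abs hk0
    rw [hk, abs_mul, abs_of_pos (by positivity)]
    nlinarith
  obtain ⟨ε, hε, hεΓ⟩ : ∃ ε : ℝ, ε ^ 2 = 1 ∧ ε * Γ = |Γ| := by
    rcases le_total 0 Γ with h | h
    · exact ⟨1, by norm_num, by rw [abs_of_nonneg h, one_mul]⟩
    · exact ⟨-1, by norm_num, by rw [abs_of_nonpos h]; ring⟩
  have hset : (∫ z in ball c r₂ \ closedBall c r₁, angEnergy g a b z)
      = ∫ z in closedBall c r₂ \ closedBall c r₁, angEnergy g a b z := by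
    refine setIntegral_congr_set ?_
    have : (ball c r₂ : Set ℂ) =ᵐ[volume] closedBall c r₂ := by
      rw [← ball_union_sphere]
      exact (union_ae_eq_left_of_ae_eq_empty
        (ae_eq_empty.2 (Measure.addHaar_sphere volume c r₂))).symm
    exact this.diff (ae_eq_refl _)
  rw [hset, integral_polarMap cE c h1.le h12.le
    (measurableSet_closedBall.diff measurableSet_closedBall) (fun z hz => by
      simp [dist_eq_norm, and_comm])]
  have cP : Continuous fun p : ℝ × ℝ => p.1 * angEnergy g a b (polarMap c p) :=
    continuous_fst.mul (cE.comp (polarMap_contDiff c).continuous)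
  have cI : Continuous fun r : ℝ => ∫ θ in (-Real.pi)..Real.pi, r * angEnergy g a b (polarMap c (r, θ)) := by
    have := intervalIntegral.continuous_parametric_intervalIntegral_of_continuous'
      (μ := volume) (f := fun r θ => r * angEnergy g a b (polarMap c (r, θ))) cP (-Real.pi) Real.pi
    exact this
  have lower : ∀ r ∈ Set.Ioc r₁ r₂, Real.pi * (1 / r - 16 / r ^ 3)
      ≤ ∫ θ in (-Real.pi)..Real.pi, r * angEnergy g a b (polarMap c (r, θ)) := by
    intro r hr
    have hr0 : 0 < r := h1.trans hr.1
    have cA : Continuous fun θ : ℝ => angCurrent g a b c (r, θ) :=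
      (current_contDiff hg.smooth (contDiff_comp_polarMap ha c)
        (contDiff_comp_polarMap hb c) (0, 1)).continuous.comp (by fun_prop)
    have m := intervalIntegral.integral_mono (μ := volume) (a := -Real.pi) (b := Real.pi)
      (f := fun θ => ε * angCurrent g a b c (r, θ) / r - (1 / (2 * r) + 8 / r ^ 3))
      (g := fun θ => r * angEnergy g a b (polarMap c (r, θ))) (by linarith)
      (Continuous.intervalIntegrable (by fun_prop) _ _)
      (Continuous.intervalIntegrable (cP.comp (by fun_prop : Continuous fun θ : ℝ => (r, θ))) _ _)
      (fun θ => by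
        have hn : ‖polarMap c (r, θ) - c‖ = r := by rw [norm_polarMap_sub, abs_of_pos hr0]
        have := le_mul_angEnergy hg ha hb c hε hr0 (θ := θ) (hgood _ (by rw [hn]; exact hr.1)
          (by rw [hn]; exact hr.2))
        beta_reduce
        linarith)
    refine le_trans ?_ m
    rw [intervalIntegral.integral_sub (Continuous.intervalIntegrable (by fun_prop) _ _)
      (Continuous.intervalIntegrable (by fun_prop) _ _), intervalIntegral.integral_div,
      intervalIntegral.integral_const_mul, intervalIntegral.integral_const]
    have hc := hjac r hr
    rw [circulation] at hc
    rw [hc, hεΓ, smul_eq_mul]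
    have : 2 * Real.pi / r ≤ |Γ| / r := by gcongr
    have e : Real.pi * (1 / r - 16 / r ^ 3)
        = 2 * Real.pi / r - (Real.pi - -Real.pi) * (1 / (2 * r) + 8 / r ^ 3) := by
      field_simp; ring
    linarith
  have hder : ∀ r ∈ Set.uIcc r₁ r₂, HasDerivAt (fun r => Real.pi * (Real.log r + 8 * (r ^ 2)⁻¹))
      (Real.pi * (1 / r - 16 / r ^ 3)) r := by
    intro r hr
    rw [Set.uIcc_of_le h12.le] at hr
    have hr0 : r ≠ 0 := (h1.trans_le hr.1).ne'
    refine (((Real.hasDerivAt_log hr0).add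
      (((hasDerivAt_pow 2 r).inv (pow_ne_zero 2 hr0)).const_mul 8)).const_mul Real.pi).congr_deriv ?_
    field_simp
    ring
  have cD : ContinuousOn (fun r : ℝ => Real.pi * (1 / r - 16 / r ^ 3)) (Set.uIcc r₁ r₂) := by
    rw [Set.uIcc_of_le h12.le]
    have : ∀ r ∈ Set.Icc r₁ r₂, r ≠ 0 := fun r hr => (h1.trans_le hr.1).ne'
    refine continuousOn_const.mul ((continuousOn_const.div continuousOn_id this).sub
      (continuousOn_const.div (continuousOn_pow 3) fun r hr => pow_ne_zero 3 (this r hr)))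
  have hD := cD.intervalIntegrable (μ := volume)
  have ftc := intervalIntegral.integral_eq_sub_of_hasDerivAt hder hD
  have hlow : (∫ r in r₁..r₂, Real.pi * (1 / r - 16 / r ^ 3))
      ≤ ∫ r in r₁..r₂, ∫ θ in (-Real.pi)..Real.pi, r * angEnergy g a b (polarMap c (r, θ)) := by
    rw [intervalIntegral.integral_of_le h12.le, intervalIntegral.integral_of_le h12.le]
    refine setIntegral_mono_on ?_ ?_ measurableSet_Ioc lower
    · exact (intervalIntegrable_iff_integrableOn_Ioc_of_le h12.le).1 hD
    · exact (intervalIntegrable_iff_integrableOn_Ioc_of_le h12.le).1 (cI.intervalIntegrable _ _)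
  rw [ftc] at hlow
  refine le_trans (le_of_eq ?_) hlow
  rw [Real.log_div (h1.trans h12).ne' h1.ne']
  ring

end AngularEnergy

section BallGrowth

/-- Union of a finite family of closed discs. -/
def discUnion (F : Finset ℕ) (a : ℕ → ℂ) (r : ℕ → ℝ) : Set ℂ := ⋃ i ∈ F, closedBall (a i) (r i)

lemma mem_discUnion {F : Finset ℕ} {a : ℕ → ℂ} {r : ℕ → ℝ} {z : ℂ} :
    z ∈ discUnion F a r ↔ ∃ i ∈ F, dist z (a i) ≤ r i := by
  simp [discUnion]

lemma measurableSet_discUnion (F : Finset ℕ) (a : ℕ → ℂ) (r : ℕ → ℝ) :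
    MeasurableSet (discUnion F a r) :=
  F.measurableSet_biUnion fun _ _ => measurableSet_closedBall

/-- Two touching discs can be replaced by one disc whose radius is the sum of the radii. -/
lemma exists_merge {F : Finset ℕ} {a : ℕ → ℂ} {r : ℕ → ℝ} {ρ : ℝ} (hρ : 0 < ρ)
    (hr : ∀ i ∈ F, ρ ≤ r i) {i j : ℕ} (hi : i ∈ F) (hj : j ∈ F) (hij : i ≠ j)
    (hd : dist (a i) (a j) ≤ r i + r j) :
    ∃ a' r', (∀ k ∈ F.erase j, ρ ≤ r' k) ∧ ∑ k ∈ F.erase j, r' k = ∑ k ∈ F, r k ∧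
      discUnion F a r ⊆ discUnion (F.erase j) a' r' := by
  have ri := hρ.trans_le (hr i hi)
  have rj := hρ.trans_le (hr j hj)
  have hi' : i ∈ F.erase j := Finset.mem_erase.2 ⟨hij, hi⟩
  let c : ℂ := AffineMap.lineMap (a i) (a j) (r j / (r i + r j))
  have hci : dist (a i) c ≤ r j := by
    rw [dist_left_lineMap, Real.norm_of_nonneg (by positivity), div_mul_eq_mul_div,
      div_le_iff₀ (by positivity)]
    gcongr
  have hcj : dist (a j) c ≤ r i := by
    rw [dist_right_lineMap, show 1 - r j / (r i + r j) = r i / (r i + r j) by field_simp; ring,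
      Real.norm_of_nonneg (by positivity), div_mul_eq_mul_div, div_le_iff₀ (by positivity)]
    gcongr
  refine ⟨Function.update a i c, Function.update r i (r i + r j), ?_, ?_, ?_⟩
  · intro k hk
    by_cases hki : k = i
    · subst hki; simp only [Function.update_self]; linarith [hr k hi]
    · rw [Function.update_of_ne hki]; exact hr k (Finset.mem_of_mem_erase hk)
  · rw [← Finset.add_sum_erase _ _ hi', Function.update_self, ← Finset.add_sum_erase F _ hj,
      ← Finset.add_sum_erase (F.erase j) r hi']
    have : ∑ x ∈ (F.erase j).erase i, Function.update r i (r i + r j) x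
        = ∑ x ∈ (F.erase j).erase i, r x :=
      Finset.sum_congr rfl fun x hx => Function.update_of_ne (Finset.ne_of_mem_erase hx) _ _
    rw [this]; ring
  · intro z hz
    rw [mem_discUnion] at hz ⊢
    obtain ⟨k, hk, hzk⟩ := hz
    by_cases hki : k = i
    · refine ⟨i, hi', ?_⟩
      rw [Function.update_self, Function.update_self]
      subst hki
      linarith [dist_triangle z (a k) c]
    · by_cases hkj : k = j
      · refine ⟨i, hi', ?_⟩
        rw [Function.update_self, Function.update_self]
        subst hkj
        linarith [dist_triangle z (a k) c]
      · exact ⟨k, Finset.mem_erase.2 ⟨hkj, hk⟩, by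
          rwa [Function.update_of_ne hki, Function.update_of_ne hki]⟩

lemma integral_eq_sum_discs {J : ℂ → ℝ} (hJ : Integrable J) {F : Finset ℕ} {a : ℕ → ℂ}
    {r : ℕ → ℝ} (hd : ∀ i ∈ F, ∀ j ∈ F, i ≠ j → r i + r j < dist (a i) (a j))
    (hJ0 : ∀ z, z ∉ discUnion F a r → J z = 0) :
    ∫ z, J z = ∑ i ∈ F, ∫ z in closedBall (a i) (r i), J z := by
  rw [← integral_biUnion_finset F (fun _ _ => measurableSet_closedBall) ?_
    (fun _ _ => hJ.integrableOn)]
  · exact (setIntegral_eq_integral_of_forall_compl_eq_zero hJ0).symm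
  · intro i hi j hj hij
    exact closedBall_disjoint_closedBall (hd i hi j hj hij)

lemma abs_integral_re_mul_le {J : ℂ → ℝ} (hJc : Continuous J) (hJ : Integrable J) {F : Finset ℕ}
    {a : ℕ → ℂ} {r : ℕ → ℝ} (hr : ∀ i ∈ F, 0 ≤ r i)
    (hd : ∀ i ∈ F, ∀ j ∈ F, i ≠ j → r i + r j < dist (a i) (a j))
    (hJ0 : ∀ z, z ∉ discUnion F a r → J z = 0)
    (hdeg : ∀ i ∈ F, ∫ z in closedBall (a i) (r i), J z = 0) :
    |∫ z, z.re * J z| ≤ (∑ i ∈ F, r i) * ∫ z, |J z| := by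
  have cR : Continuous fun z : ℂ => z.re * J z := Complex.continuous_re.mul hJc
  have comp : IsCompact (discUnion F a r) := F.isCompact_biUnion fun _ _ => isCompact_closedBall _ _
  have iR : Integrable fun z : ℂ => z.re * J z := by
    refine (integrableOn_iff_integrable_of_support_subset (s := discUnion F a r) ?_).1
      (cR.continuousOn.integrableOn_compact comp)
    intro z hz
    by_contra h
    exact hz (by simp [hJ0 z h])
  rw [integral_eq_sum_discs iR hd fun z hz => by rw [hJ0 z hz, mul_zero], Finset.sum_mul]
  refine (Finset.abs_sum_le_sum_abs _ _).trans (Finset.sum_le_sum fun i hi => ?_)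
  have e : (∫ z in closedBall (a i) (r i), z.re * J z)
      = ∫ z in closedBall (a i) (r i), (z.re - (a i).re) * J z := by
    have : (fun z : ℂ => (z.re - (a i).re) * J z) = fun z => z.re * J z - (a i).re * J z := by
      funext z; ring
    rw [this, integral_sub iR.integrableOn (hJ.const_mul _).integrableOn, integral_const_mul,
      hdeg i hi, mul_zero, sub_zero]
  rw [e, ← Real.norm_eq_abs]
  calc ‖∫ z in closedBall (a i) (r i), (z.re - (a i).re) * J z‖
      ≤ ∫ z in closedBall (a i) (r i), r i * |J z| := by
        refine norm_integral_le_of_norm_le (hJ.abs.const_mul _).integrableOn ?_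
        refine (ae_restrict_iff' measurableSet_closedBall).2 (Eventually.of_forall fun z hz => ?_)
        rw [Real.norm_eq_abs, abs_mul]
        gcongr
        rw [mem_closedBall, dist_eq_norm] at hz
        exact (Complex.abs_re_le_norm (z - a i)).trans hz
    _ = r i * ∫ z in closedBall (a i) (r i), |J z| := integral_const_mul _ _
    _ ≤ r i * ∫ z, |J z| := mul_le_mul_of_nonneg_left
        (setIntegral_le_integral hJ.abs (Eventually.of_forall fun z => abs_nonneg _)) (hr i hi)

/-- Growing and merging discs: lower bound for the energy outside a family of discs in terms of
the total radius of a larger family on each disc of which `J` has zero mean. -/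
theorem ball_growth {J eh : ℂ → ℝ} {bad : Set ℂ} (hJc : Continuous J) (hJ : Integrable J)
    (hJbad : ∀ z, z ∉ bad → J z = 0) (hJtot : ∫ z, J z = 0) (heh : Integrable eh)
    (heh0 : ∀ z, 0 ≤ eh z)
    (hann : ∀ (c : ℂ) (r₁ r₂ : ℝ), 0 < r₁ → r₁ < r₂ →
      (∀ z : ℂ, r₁ < ‖z - c‖ → ‖z - c‖ ≤ r₂ → z ∉ bad) →
      ∫ z in closedBall c r₁, J z ≠ 0 →
      Real.pi * (Real.log (r₂ / r₁) - 8 * (1 / r₁ ^ 2 - 1 / r₂ ^ 2))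
        ≤ ∫ z in ball c r₂ \ closedBall c r₁, eh z) (n : ℕ) :
    ∀ (F : Finset ℕ) (a : ℕ → ℂ) (r : ℕ → ℝ) (ρ : ℝ), F.card = n → F.Nonempty → 0 < ρ →
      (∀ i ∈ F, ρ ≤ r i) → bad ⊆ discUnion F a r →
      ∃ R', ∑ i ∈ F, r i ≤ R' ∧ |∫ z, z.re * J z| ≤ R' * ∫ z, |J z| ∧
        2 * Real.pi * (Real.log (R' / ∑ i ∈ F, r i)
            + 8 / (ρ * (R' / ∑ i ∈ F, r i)) ^ 2 - 8 / ρ ^ 2)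
          ≤ ∫ z in (discUnion F a r)ᶜ, eh z := by
  have hpi := Real.pi_pos
  induction n with
  | zero => intro F a r ρ hc hne; simp [Finset.card_eq_zero.1 hc] at hne
  | succ n ih =>
    intro F a r ρ hcard hne hρ hr hcov
    have hrpos : ∀ i ∈ F, 0 < r i := fun i hi => hρ.trans_le (hr i hi)
    have hRpos : 0 < ∑ i ∈ F, r i := Finset.sum_pos hrpos hne
    have hJ0 : ∀ z, z ∉ discUnion F a r → J z = 0 := fun z hz => hJbad z fun h => hz (hcov h)
    by_cases hd : ∀ i ∈ F, ∀ j ∈ F, i ≠ j → r i + r j < dist (a i) (a j)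
    swap
    · push Not at hd
      obtain ⟨i, hi, j, hj, hij, hdij⟩ := hd
      obtain ⟨a', r', hr', hsum, hsub⟩ := exists_merge hρ hr hi hj hij hdij
      obtain ⟨R', h1, h2, h3⟩ := ih (F.erase j) a' r' ρ
        (by rw [Finset.card_erase_of_mem hj, hcard]; rfl) ⟨i, Finset.mem_erase.2 ⟨hij, hi⟩⟩ hρ hr'
        (hcov.trans hsub)
      rw [hsum] at h1 h3
      exact ⟨R', h1, h2, h3.trans (setIntegral_mono_set heh.integrableOn
        (Eventually.of_forall heh0) (Set.compl_subset_compl.2 hsub).eventuallyLE)⟩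
    by_cases hdeg : ∀ i ∈ F, ∫ z in closedBall (a i) (r i), J z = 0
    · refine ⟨_, le_rfl, abs_integral_re_mul_le hJc hJ (fun i hi => (hrpos i hi).le) hd hJ0 hdeg, ?_⟩
      rw [div_self hRpos.ne']
      simp only [Real.log_one, mul_one, zero_add, sub_self, mul_zero]
      exact integral_nonneg heh0
    push Not at hdeg
    obtain ⟨i₀, hi₀, hdi₀⟩ := hdeg
    obtain ⟨j₀, hj₀, hij₀, hdj₀⟩ : ∃ j ∈ F, i₀ ≠ j ∧ ∫ z in closedBall (a j) (r j), J z ≠ 0 := by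
      by_contra! h
      rw [integral_eq_sum_discs hJ hd hJ0,
        Finset.sum_eq_single i₀ (fun j hj hji => h j hj hji.symm) (fun h => (h hi₀).elim)] at hJtot
      exact hdi₀ hJtot
    obtain ⟨⟨i, j⟩, hmem, hmin⟩ := F.offDiag.exists_min_image
      (fun q => dist (a q.1) (a q.2) / (r q.1 + r q.2)) ⟨(i₀, j₀), Finset.mem_offDiag.2 ⟨hi₀, hj₀, hij₀⟩⟩
    obtain ⟨hi, hj, hij⟩ := Finset.mem_offDiag.1 hmem
    simp only at hi hj hij hmin
    set l := dist (a i) (a j) / (r i + r j) with hl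
    have hl1 : 1 < l := by
      rw [hl, one_lt_div (add_pos (hrpos i hi) (hrpos j hj))]
      exact hd i hi j hj hij
    have hl0 : 0 < l := by linarith
    have hlmin : ∀ p ∈ F, ∀ q ∈ F, p ≠ q → l * r p + l * r q ≤ dist (a p) (a q) := by
      intro p hp q hq hpq
      have := hmin (p, q) (Finset.mem_offDiag.2 ⟨hp, hq, hpq⟩)
      rw [le_div_iff₀ (add_pos (hrpos p hp) (hrpos q hq))] at this
      linarith
    obtain ⟨a', r', hr', hsum, hsub⟩ := exists_merge (a := a) (r := fun k => l * r k) (mul_pos hl0 hρ)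
      (fun k hk => mul_le_mul_of_nonneg_left (hr k hk) hl0.le) hi hj hij (by
        have := add_pos (hrpos i hi) (hrpos j hj)
        rw [hl, ← mul_add, div_mul_cancel₀ _ this.ne'])
    have hgrow : discUnion F a r ⊆ discUnion F a fun k => l * r k := by
      intro z hz
      rw [mem_discUnion] at hz ⊢
      obtain ⟨k, hk, hzk⟩ := hz
      exact ⟨k, hk, by nlinarith [hrpos k hk]⟩
    obtain ⟨R', h1, h2, h3⟩ := ih (F.erase j) a' r' (l * ρ)
      (by rw [Finset.card_erase_of_mem hj, hcard]; rfl) ⟨i, Finset.mem_erase.2 ⟨hij, hi⟩⟩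
      (mul_pos hl0 hρ) hr' ((hcov.trans hgrow).trans hsub)
    rw [← Finset.mul_sum] at hsum
    rw [hsum] at h1 h3
    set R := ∑ k ∈ F, r k with hR
    have hR'0 : 0 < R' := lt_of_lt_of_le (mul_pos hl0 hRpos) h1
    refine ⟨R', by nlinarith, h2, ?_⟩
    let A : ℕ → Set ℂ := fun k => ball (a k) (l * r k) \ closedBall (a k) (r k)
    have mA : ∀ k, MeasurableSet (A k) := fun k => measurableSet_ball.diff measurableSet_closedBall
    have out : ∀ k ∈ F, ∀ z, r k < dist z (a k) → dist z (a k) ≤ l * r k → z ∉ discUnion F a r := by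
      intro k hk z hz1 hz2 hz
      obtain ⟨q, hq, hzq⟩ := mem_discUnion.1 hz
      by_cases hkq : k = q
      · subst hkq; linarith
      · have t1 := hlmin k hk q hq hkq
        have t2 := dist_triangle_left (a k) (a q) z
        nlinarith [hrpos q hq]
    have gain : ∀ k ∈ F, ∫ z in closedBall (a k) (r k), J z ≠ 0 →
        Real.pi * (Real.log l - 8 / ρ ^ 2 + 8 / (l * ρ) ^ 2) ≤ ∫ z in A k, eh z := by
      intro k hk hdk
      have hrk := hrpos k hk
      refine le_trans ?_ (hann (a k) (r k) (l * r k) hrk (by nlinarith)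
        (fun z hz1 hz2 hz => out k hk z (by rwa [dist_eq_norm]) (by rwa [dist_eq_norm]) (hcov hz)) hdk)
      rw [mul_div_cancel_right₀ _ hrk.ne']
      gcongr ?_ * ?_
      have e1 : 8 / ρ ^ 2 - 8 / (l * ρ) ^ 2 = 8 * (1 - 1 / l ^ 2) / ρ ^ 2 := by field_simp
      have e2 : 8 * (1 / r k ^ 2 - 1 / (l * r k) ^ 2) = 8 * (1 - 1 / l ^ 2) / r k ^ 2 := by field_simp
      have : 8 * (1 - 1 / l ^ 2) / r k ^ 2 ≤ 8 * (1 - 1 / l ^ 2) / ρ ^ 2 := by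
        have : 0 ≤ 8 * (1 - 1 / l ^ 2) := by
          have : 1 / l ^ 2 ≤ 1 := by rw [div_le_one (by positivity)]; nlinarith
          linarith
        have := hr k hk
        gcongr
      linarith
    have disjA : Disjoint (A i₀) (A j₀) := by
      have : Disjoint (ball (a i₀) (l * r i₀)) (ball (a j₀) (l * r j₀)) :=
        ball_disjoint_ball (hlmin i₀ hi₀ j₀ hj₀ hij₀)
      exact this.mono Set.sdiff_subset Set.sdiff_subset
    have disjU : ∀ k ∈ F, Disjoint (A k) (discUnion (F.erase j) a' r')ᶜ := by
      intro k hk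
      rw [Set.disjoint_compl_right_iff_subset]
      intro z hz
      exact hsub (mem_discUnion.2 ⟨k, hk, (mem_ball.1 hz.1).le⟩)
    have subU : (A i₀ ∪ A j₀) ∪ (discUnion (F.erase j) a' r')ᶜ ⊆ (discUnion F a r)ᶜ := by
      have key : ∀ k ∈ F, A k ⊆ (discUnion F a r)ᶜ := fun k hk z hz =>
        out k hk z (by simpa using hz.2) (mem_ball.1 hz.1).le
      exact Set.union_subset (Set.union_subset (key i₀ hi₀) (key j₀ hj₀))
        (Set.compl_subset_compl.2 (hgrow.trans hsub))
    have tot := setIntegral_mono_set (μ := volume) heh.integrableOn (Eventually.of_forall heh0)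
      subU.eventuallyLE
    rw [setIntegral_union (Set.disjoint_union_left.2 ⟨disjU i₀ hi₀, disjU j₀ hj₀⟩)
      (measurableSet_discUnion _ _ _).compl heh.integrableOn heh.integrableOn,
      setIntegral_union disjA (mA j₀) heh.integrableOn heh.integrableOn] at tot
    have g1 := gain i₀ hi₀ hdi₀
    have g2 := gain j₀ hj₀ hdj₀
    have e1 : Real.log (R' / R) = Real.log (R' / (l * R)) + Real.log l := by
      rw [← Real.log_mul (by positivity) hl0.ne']
      congr 1
      field_simp
    have e2 : l * ρ * (R' / (l * R)) = ρ * (R' / R) := by field_simp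
    rw [e2] at h3
    rw [e1]
    nlinarith

end BallGrowth

section Cover
variable {c : ℝ} {a b : ℂ → ℝ}

/-- The set where the squared modulus is at most `1 / 4`. -/
def badSet (a b : ℂ → ℝ) : Set ℂ := {z | a z * a z + b z * b z ≤ 1 / 4}

lemma abs_sub_le_of_dirD_le {f : ℂ → ℝ} (hf : Differentiable ℝ f) {M : ℝ}
    (h1 : ∀ z, |dirD 1 f z| ≤ M) (hI : ∀ z, |dirD Complex.I f z| ≤ M) (z w : ℂ) :
    |f z - f w| ≤ 2 * M * ‖z - w‖ := by
  refine convex_univ.norm_image_sub_le_of_norm_fderiv_le (𝕜 := ℝ) (fun x _ => hf x) (fun x _ => ?_)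
    (Set.mem_univ w) (Set.mem_univ z)
  have hM : 0 ≤ M := (abs_nonneg _).trans (h1 x)
  refine ContinuousLinearMap.opNorm_le_bound _ (by positivity) fun v => ?_
  have e : fderiv ℝ f x v = v.re * dirD 1 f x + v.im * dirD Complex.I f x := by
    conv_lhs => rw [show v = v.re • (1 : ℂ) + v.im • Complex.I by
      apply Complex.ext <;> simp]
    rw [map_add, map_smul, map_smul]; rfl
  rw [e, Real.norm_eq_abs]
  calc |v.re * dirD 1 f x + v.im * dirD Complex.I f x|
      ≤ |v.re * dirD 1 f x| + |v.im * dirD Complex.I f x| := abs_add_le _ _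
    _ = |v.re| * |dirD 1 f x| + |v.im| * |dirD Complex.I f x| := by rw [abs_mul, abs_mul]
    _ ≤ ‖v‖ * M + ‖v‖ * M := by
        have := Complex.abs_re_le_norm v
        have := Complex.abs_im_le_norm v
        have := h1 x
        have := hI x
        gcongr
    _ = 2 * M * ‖v‖ := by ring

lemma pot_ge_near_badSet (h : RealTW c a b) (hc0 : 0 ≤ c) (hc : c ≤ 1) {z w : ℂ}
    (hz : z ∈ badSet a b) (hw : dist w z < 1 / 2048) : 1 / 4 ≤ pot a b w := by
  have g := h.gradient_le hc0 hc
  have la := abs_sub_le_of_dirD_le (smooth_differentiable h.smooth_re) (fun z => (g z).1)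
    (fun z => (g z).2.2.1) w z
  have lb := abs_sub_le_of_dirD_le (smooth_differentiable h.smooth_im) (fun z => (g z).2.1)
    (fun z => (g z).2.2.2) w z
  rw [dist_eq_norm] at hw
  have la' : |a w - a z| ≤ 1 / 8 := by linarith
  have lb' : |b w - b z| ≤ 1 / 8 := by linarith
  rw [abs_le] at la' lb'
  have hz' : a z * a z + b z * b z ≤ 1 / 4 := hz
  have key : a w ^ 2 + b w ^ 2 ≤ 1 / 2 := by
    have e : ∀ x y : ℝ, -(1 / 8) ≤ y - x → y - x ≤ 1 / 8 → y ^ 2 ≤ 3 / 2 * x ^ 2 + 3 / 64 := by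
      intro x y h1 h2
      have : (y - x) ^ 2 ≤ 1 / 64 := by nlinarith
      nlinarith [sq_nonneg (x - 2 * (y - x))]
    have := e _ _ la'.1 la'.2
    have := e _ _ lb'.1 lb'.2
    linarith
  unfold pot
  nlinarith

lemma exists_cover (h : RealTW c a b) (hc0 : 0 ≤ c) (hc : c ≤ 1) (hV : Integrable (pot a b)) :
    ∃ (N : ℕ) (x : ℕ → ℂ), N * (1 / 4 * volume.real (ball (0 : ℂ) (1 / 2048))) ≤ ∫ z, pot a b z ∧
      badSet a b ⊆ discUnion (Finset.range N) x (fun _ => 1) := by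
  have hpot0 : ∀ z, 0 ≤ pot a b z := fun z => sq_nonneg _
  set v := 1 / 4 * volume.real (ball (0 : ℂ) (1 / 2048)) with hv
  have hv0 : 0 < v := by
    have : 0 < volume.real (ball (0 : ℂ) (1 / 2048)) :=
      ENNReal.toReal_pos (measure_ball_pos _ _ (by norm_num)).ne' measure_ball_lt_top.ne
    positivity
  have count : ∀ T : Finset ℂ, (T : Set ℂ) ⊆ badSet a b →
      (∀ s ∈ T, ∀ t ∈ T, s ≠ t → 1 / 1024 ≤ dist s t) → T.card * v ≤ ∫ z, pot a b z := by
    intro T hT hsep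
    calc T.card * v = ∑ t ∈ T, v := by rw [Finset.sum_const, nsmul_eq_mul]
      _ ≤ ∑ t ∈ T, ∫ z in ball t (1 / 2048), pot a b z := by
          refine Finset.sum_le_sum fun t ht => ?_
          have e : v = ∫ z in ball t (1 / 2048), (1 / 4 : ℝ) := by
            rw [setIntegral_const, smul_eq_mul, hv, mul_comm, measureReal_def, measureReal_def,
              Measure.addHaar_ball_center volume t]
          rw [e]
          refine setIntegral_mono_on (integrableOn_const measure_ball_lt_top.ne) hV.integrableOn
            measurableSet_ball fun z hz => pot_ge_near_badSet h hc0 hc (hT ht) hz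
      _ = ∫ z in ⋃ t ∈ T, ball t (1 / 2048), pot a b z := by
          rw [integral_biUnion_finset T (fun _ _ => measurableSet_ball) ?_ fun _ _ => hV.integrableOn]
          intro s hs t ht hst
          exact ball_disjoint_ball (by have := hsep s hs t ht hst; linarith)
      _ ≤ ∫ z, pot a b z := setIntegral_le_integral hV (Eventually.of_forall hpot0)
  let S : Set ℕ := {n | ∃ T : Finset ℂ, (T : Set ℂ) ⊆ badSet a b ∧
    (∀ s ∈ T, ∀ t ∈ T, s ≠ t → 1 / 1024 ≤ dist s t) ∧ T.card = n}
  have hS : BddAbove S := by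
    refine ⟨⌊(∫ z, pot a b z) / v⌋₊, ?_⟩
    rintro n ⟨T, h1, h2, rfl⟩
    exact Nat.le_floor ((le_div_iff₀ hv0).2 (count T h1 h2))
  obtain ⟨T, hT1, hT2, hT3⟩ := Nat.sSup_mem (s := S) ⟨0, ∅, by simp⟩ hS
  refine ⟨T.card, fun k => if hk : k < T.card then (T.equivFin.symm ⟨k, hk⟩ : ℂ) else 0,
    count T hT1 hT2, fun z hz => ?_⟩
  have near : ∃ t ∈ T, dist z t < 1 / 1024 := by
    by_contra! hfar
    have hzT : z ∉ T := fun hz' => by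
      have := hfar z hz'
      rw [dist_self] at this
      norm_num at this
    have : T.card + 1 ∈ S := by
      refine ⟨insert z T, ?_, ?_, Finset.card_insert_of_notMem hzT⟩
      · rw [Finset.coe_insert]; exact Set.insert_subset hz hT1
      · intro s hs t ht hst
        rcases Finset.mem_insert.1 hs with rfl | hs' <;>
          rcases Finset.mem_insert.1 ht with rfl | ht'
        · exact (hst rfl).elim
        · exact hfar t ht'
        · rw [dist_comm]; exact hfar s hs'
        · exact hT2 s hs' t ht' hst
    have := le_csSup hS this
    omega
  obtain ⟨t, ht, hzt⟩ := near
  refine mem_discUnion.2 ⟨T.equivFin ⟨t, ht⟩, Finset.mem_range.2 (T.equivFin ⟨t, ht⟩).2, ?_⟩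
  rw [dif_pos (T.equivFin ⟨t, ht⟩).2]
  simp only [Fin.eta, Equiv.symm_apply_apply]
  linarith

lemma abs_wJac_le {g : ℝ → ℝ} {K : ℝ} (hg : Regularizer g K) (h : RealTW c a b) (hc0 : 0 ≤ c)
    (hc : c ≤ 1) (z : ℂ) : |wJac g a b 1 Complex.I z| ≤ 65536 * K * pot a b z := by
  by_cases hz : 1 / 4 < a z * a z + b z * b z
  · have := hg.nonneg
    simp only [wJac]
    rw [hg.deriv_eq _ hz, zero_mul, abs_zero]
    unfold pot
    positivity
  · obtain ⟨h1, h2, h3, h4⟩ := h.gradient_le hc0 hc z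
    have hp : 1 / 2 ≤ pot a b z := by unfold pot; nlinarith
    have b1 : |dirD 1 a z * dirD Complex.I b z - dirD Complex.I a z * dirD 1 b z|
        ≤ 128 * 128 + 128 * 128 := by
      refine (abs_sub _ _).trans ?_
      rw [abs_mul, abs_mul]
      gcongr
    simp only [wJac]
    rw [abs_mul]
    have b2 := hg.deriv_bound (a z * a z + b z * b z)
    have := hg.nonneg
    calc _ ≤ K * (128 * 128 + 128 * 128) := by gcongr
      _ ≤ _ := by nlinarith

/-- The reflection `z ↦ -conj z`. -/
def reflectLIE : ℂ ≃ₗᵢ[ℝ] ℂ := Complex.conjLIE.trans (LinearIsometryEquiv.neg ℝ)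

lemma reflectLIE_apply (z : ℂ) : reflectLIE z = -(starRingEnd ℂ) z := rfl

lemma dirD_reflect {f : ℂ → ℝ} (hf : Differentiable ℝ f) (hs : ∀ z, f (reflectLIE z) = f z) (e z : ℂ) :
    dirD (reflectLIE e) f (reflectLIE z) = dirD e f z := by
  have h1 := (hf (reflectLIE z)).hasFDerivAt.comp z
    (reflectLIE.toContinuousLinearEquiv : ℂ →L[ℝ] ℂ).hasFDerivAt
  have h2 : HasFDerivAt f ((fderiv ℝ f (reflectLIE z)).comp
      (reflectLIE.toContinuousLinearEquiv : ℂ →L[ℝ] ℂ)) z :=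
    h1.congr_of_eventuallyEq (Eventually.of_forall fun w => (hs w).symm)
  simp only [dirD]
  rw [h2.fderiv]
  rfl

lemma integral_wJac_eq_zero {g : ℝ → ℝ} (ha : Differentiable ℝ a) (hb : Differentiable ℝ b)
    (hsa : ∀ z, a (reflectLIE z) = a z) (hsb : ∀ z, b (reflectLIE z) = b z) :
    ∫ z, wJac g a b 1 Complex.I z = 0 := by
  have e1 : reflectLIE (-1) = 1 := by simp [reflectLIE_apply]
  have eI : reflectLIE Complex.I = Complex.I := by simp [reflectLIE_apply]
  have neg1 : ∀ f : ℂ → ℝ, ∀ z, dirD (-1) f z = -dirD 1 f z := fun f z => by simp [dirD]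
  have odd : ∀ z, wJac g a b 1 Complex.I (reflectLIE z) = -wJac g a b 1 Complex.I z := by
    intro z
    have a1 := dirD_reflect ha hsa (-1) z
    have b1 := dirD_reflect hb hsb (-1) z
    have aI := dirD_reflect ha hsa Complex.I z
    have bI := dirD_reflect hb hsb Complex.I z
    rw [e1, neg1] at a1 b1
    rw [eI] at aI bI
    simp only [wJac, hsa, hsb, a1, b1, aI, bI]
    ring
  have := reflectLIE.measurePreserving.integral_comp
    reflectLIE.toHomeomorph.measurableEmbedding (wJac g a b 1 Complex.I)
  simp only [odd] at this
  rw [integral_neg] at this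
  linarith

end Cover

section Conclusion

/-- Squared gradient of the modulus (zero where the modulus vanishes). -/
def modGrad2 (a b : ℂ → ℝ) (z : ℂ) : ℝ :=
  ((a z * dirD 1 a z + b z * dirD 1 b z) ^ 2
    + (a z * dirD Complex.I a z + b z * dirD Complex.I b z) ^ 2) / (a z * a z + b z * b z)

lemma sq_lagrange (x y p q : ℝ) :
    (x * q - y * p) ^ 2 = (x * x + y * y) * (p ^ 2 + q ^ 2) - (x * p + y * q) ^ 2 := by ring

lemma modGrad2_nonneg (a b : ℂ → ℝ) (z : ℂ) : 0 ≤ modGrad2 a b z :=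
  div_nonneg (by positivity) (add_nonneg (mul_self_nonneg _) (mul_self_nonneg _))

lemma modGrad2_le_grad2 (a b : ℂ → ℝ) (z : ℂ) : modGrad2 a b z ≤ grad2 a b z := by
  have hs : 0 ≤ a z * a z + b z * b z := add_nonneg (mul_self_nonneg _) (mul_self_nonneg _)
  refine div_le_of_le_mul₀ hs (by unfold grad2; positivity) ?_
  have h1 := sq_lagrange (a z) (b z) (dirD 1 a z) (dirD 1 b z)
  have h2 := sq_lagrange (a z) (b z) (dirD Complex.I a z) (dirD Complex.I b z)
  unfold grad2
  nlinarith [sq_nonneg (a z * dirD 1 b z - b z * dirD 1 a z),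
    sq_nonneg (a z * dirD Complex.I b z - b z * dirD Complex.I a z)]

lemma angEnergy_le {g : ℝ → ℝ} {K : ℝ} (hg : Regularizer g K) (a b : ℂ → ℝ) (z : ℂ) :
    angEnergy g a b z ≤ 1 / 2 * grad2 a b z - 1 / 2 * modGrad2 a b z + 1 / 8 * pot a b z := by
  have hs : 0 ≤ a z * a z + b z * b z := add_nonneg (mul_self_nonneg _) (mul_self_nonneg _)
  unfold angEnergy
  have key : g (a z * a z + b z * b z) * ((a z * dirD 1 b z - b z * dirD 1 a z) ^ 2
      + (a z * dirD Complex.I b z - b z * dirD Complex.I a z) ^ 2)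
      ≤ grad2 a b z - modGrad2 a b z := by
    rcases hs.eq_or_lt with h0 | hpos
    · have ha : a z = 0 := by nlinarith [mul_self_nonneg (a z), mul_self_nonneg (b z)]
      have hb : b z = 0 := by nlinarith [mul_self_nonneg (a z), mul_self_nonneg (b z)]
      simp only [ha, hb, zero_mul, sub_self]
      have := modGrad2_le_grad2 a b z
      simp
      exact this
    · obtain ⟨g0, g1⟩ := hg.nonneg_and_mul_le _ hs
      set s := a z * a z + b z * b z with hsdef
      have e : grad2 a b z - modGrad2 a b z = ((a z * dirD 1 b z - b z * dirD 1 a z) ^ 2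
          + (a z * dirD Complex.I b z - b z * dirD Complex.I a z) ^ 2) / s := by
        have h1 := sq_lagrange (a z) (b z) (dirD 1 a z) (dirD 1 b z)
        have h2 := sq_lagrange (a z) (b z) (dirD Complex.I a z) (dirD Complex.I b z)
        rw [← hsdef] at h1 h2
        unfold modGrad2 grad2
        rw [← hsdef, h1, h2]
        field_simp
        ring
      rw [e, le_div_iff₀ hpos]
      have : 0 ≤ (a z * dirD 1 b z - b z * dirD 1 a z) ^ 2
          + (a z * dirD Complex.I b z - b z * dirD Complex.I a z) ^ 2 := by positivity
      nlinarith
  linarith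

lemma eventually_log_le (A B η : ℝ) (hη : 0 < η) :
    ∀ᶠ p in atTop, A * Real.log p + B ≤ η * p := by
  have h1 : (fun p : ℝ => A * Real.log p + B) =o[atTop] (id : ℝ → ℝ) :=
    (Real.isLittleO_log_id_atTop.const_mul_left A).add
      (Asymptotics.isLittleO_const_id_atTop B)
  filter_upwards [h1.bound hη, eventually_ge_atTop 0] with p hp hp0
  rw [id, Real.norm_eq_abs, Real.norm_eq_abs, abs_of_nonneg hp0] at hp
  exact (le_abs_self _).trans hp

set_option maxHeartbeats 1000000 in
/-- The real-variable form of the modulus energy bound. -/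
theorem modulus_energy_bound_real (Λ : ℝ) : ∃ C p₀ : ℝ, 0 < C ∧ 0 < p₀ ∧
    ∀ (a b : ℂ → ℝ) (p c : ℝ), FinTW c a b → (∀ z, a (reflectLIE z) = a z) →
      (∀ z, b (reflectLIE z) = b z) → 1 / 2 * (∫ z, momDens a b z) = p →
      1 / 2 * (∫ z, grad2 a b z) + 1 / 4 * (∫ z, pot a b z) ≤ 2 * Real.pi * Real.log p + Λ →
      p₀ ≤ p → Integrable (modGrad2 a b) ∧
        (∫ z, modGrad2 a b z) + 1 / 2 * (∫ z, pot a b z) ≤ C := by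
  have hpi := Real.pi_pos
  obtain ⟨g, K, hg⟩ := exists_regularizer
  have hK := hg.nonneg
  obtain ⟨v, hv⟩ : ∃ v, v = 1 / 4 * volume.real (ball (0 : ℂ) (1 / 2048)) := ⟨_, rfl⟩
  have hv0 : 0 < v := by
    have : 0 < volume.real (ball (0 : ℂ) (1 / 2048)) :=
      ENNReal.toReal_pos (measure_ball_pos _ _ (by norm_num)).ne' measure_ball_lt_top.ne
    rw [hv]; positivity
  set M₁ := 4 * (24 + 12 * K) with hM₁
  have hM₁1 : 1 ≤ M₁ := by linarith
  set M₂ := 65536 * (K + 1) with hM₂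
  have hM₂0 : 0 < M₂ := by positivity
  obtain ⟨p₁, hp₁⟩ := eventually_atTop.1
    (eventually_log_le (2 * Real.pi) Λ (1 / (2 * M₁)) (by positivity))
  set κ := v / (2 * M₂) with hκ
  have hκ0 : 0 < κ := by positivity
  set η := 1 / (64 * Real.pi) with hη
  have hη0 : 0 < η := by positivity
  set C' := Λ + 16 * Real.pi - 2 * Real.pi * Real.log κ - 4 * Real.pi * (1 + Real.log η) with hC'
  refine ⟨max 1 (8 * C'), max 1 p₁, by positivity, by positivity, ?_⟩
  intro a b p c h hsa hsb hmom hE hp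
  have hp1 : 1 ≤ p := (le_max_left _ _).trans hp
  have hEp := hp₁ p ((le_max_right _ _).trans hp)
  have ha := h.smooth_re
  have hb := h.smooth_im
  have iD : Integrable (modGrad2 a b) := by
    refine h.int_grad.mono' (Measurable.aestronglyMeasurable ?_)
      (Eventually.of_forall fun z => ?_)
    · have := (dirD_contDiff ha 1).continuous.measurable
      have := (dirD_contDiff ha Complex.I).continuous.measurable
      have := (dirD_contDiff hb 1).continuous.measurable
      have := (dirD_contDiff hb Complex.I).continuous.measurable
      have := ha.continuous.measurable
      have := hb.continuous.measurable
      unfold modGrad2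
      fun_prop
    · rw [Real.norm_of_nonneg (modGrad2_nonneg a b z)]; exact modGrad2_le_grad2 a b z
  refine ⟨iD, le_trans ?_ (le_max_right _ _)⟩
  set G := ∫ z, grad2 a b z with hG
  set V := ∫ z, pot a b z with hV
  set D := ∫ z, modGrad2 a b z with hD
  have hG0 : 0 ≤ G := integral_nonneg fun z => by unfold grad2; positivity
  have hV0 : 0 ≤ V := integral_nonneg fun z => by unfold pot; positivity
  have hD0 : 0 ≤ D := integral_nonneg fun z => modGrad2_nonneg a b z
  have hE2 : M₁ * (1 / 2 * G + 1 / 4 * V) ≤ p / 2 := by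
    have : 1 / 2 * G + 1 / 4 * V ≤ 1 / (2 * M₁) * p := hE.trans hEp
    calc _ ≤ M₁ * (1 / (2 * M₁) * p) := by gcongr
      _ = p / 2 := by field_simp
  have hc0 := h.speed_pos
  have hc1 : c ≤ 1 := by
    have := h.speed_mul_le
    rw [hmom] at this
    by_contra! hc
    nlinarith
  obtain ⟨N, x, hN, hcov⟩ := exists_cover h.toRealTW hc0.le hc1 h.int_pot
  rw [← hv] at hN
  have cJ := wJac_continuous hg.smooth ha hb 1 Complex.I
  have leJ := abs_wJac_le hg h.toRealTW hc0.le hc1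
  have iJ : Integrable (wJac g a b 1 Complex.I) :=
    (h.int_pot.const_mul (65536 * K)).mono' cJ.aestronglyMeasurable (Eventually.of_forall leJ)
  have hJabs : ∫ z, |wJac g a b 1 Complex.I z| ≤ M₂ * V := by
    calc _ ≤ ∫ z, 65536 * K * pot a b z := integral_mono iJ.abs (h.int_pot.const_mul _) leJ
      _ = 65536 * K * V := integral_const_mul _ _
      _ ≤ M₂ * V := by gcongr; linarith
  have good : ∀ z, z ∉ badSet a b → 1 / 4 < a z * a z + b z * b z := fun z hz => not_le.1 hz
  have hJbad : ∀ z, z ∉ badSet a b → wJac g a b 1 Complex.I z = 0 := by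
    intro z hz
    simp only [wJac]
    rw [hg.deriv_eq _ (good z hz), zero_mul]
  have bdd : ∃ ρ : ℝ, ∀ z : ℂ, ρ < ‖z‖ → 1 / 4 < a z * a z + b z * b z := by
    have comp : IsCompact (discUnion (Finset.range N) x fun _ => 1) :=
      (Finset.range N).isCompact_biUnion fun _ _ => isCompact_closedBall _ _
    obtain ⟨ρ, hρ⟩ := comp.isBounded.subset_closedBall 0
    refine ⟨ρ, fun z hz => good z fun hb => ?_⟩
    have := hρ (hcov hb)
    rw [mem_closedBall, dist_zero_right] at this
    linarith
  obtain ⟨ρ, hρ⟩ := bdd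
  have hmomle := h.mom_le hc1 hg hρ
  rw [hmom] at hmomle
  have hI : p / 2 ≤ ∫ z : ℂ, z.re * wJac g a b 1 Complex.I z := by
    have : (24 + 12 * K) * (G + V) ≤ M₁ * (1 / 2 * G + 1 / 4 * V) := by
      rw [hM₁]; nlinarith
    linarith
  have iA : Integrable (angEnergy g a b) := by
    refine (((h.int_grad.const_mul (1 / 2)).sub (iD.const_mul (1 / 2))).add
      (h.int_pot.const_mul (1 / 8))).mono' (angEnergy_continuous hg.smooth.continuous ha hb).aestronglyMeasurable
      (Eventually.of_forall fun z => ?_)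
    rw [Real.norm_of_nonneg (angEnergy_nonneg hg z)]
    exact angEnergy_le hg a b z
  have hang : ∫ z, angEnergy g a b z ≤ 1 / 2 * G - 1 / 2 * D + 1 / 8 * V := by
    have i1 : Integrable fun z => 1 / 2 * grad2 a b z := h.int_grad.const_mul _
    have i2 : Integrable fun z => 1 / 2 * modGrad2 a b z := iD.const_mul _
    have i3 : Integrable fun z => 1 / 8 * pot a b z := h.int_pot.const_mul _
    have i4 : Integrable fun z => 1 / 2 * grad2 a b z - 1 / 2 * modGrad2 a b z := i1.sub i2
    have := integral_mono (μ := volume) iA (i4.add i3) (angEnergy_le hg a b)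
    refine this.trans (le_of_eq ?_)
    rw [integral_add' i4 i3, integral_sub i1 i2, integral_const_mul, integral_const_mul,
      integral_const_mul]
  have hN1 : 1 ≤ N := by
    by_contra! hN0
    have : N = 0 := by omega
    subst this
    have : ∀ z : ℂ, z.re * wJac g a b 1 Complex.I z = 0 := fun z => by
      rw [hJbad z fun hz => by simpa [discUnion] using hcov hz, mul_zero]
    simp only [this, integral_zero] at hI
    linarith
  have hN1' : (1 : ℝ) ≤ N := by exact_mod_cast hN1
  obtain ⟨R', hR1, hR2, hR3⟩ := ball_growth cJ iJ hJbad
    (integral_wJac_eq_zero (smooth_differentiable ha) (smooth_differentiable hb) hsa hsb) iA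
    (angEnergy_nonneg hg)
    (fun c r₁ r₂ h1 h12 hbad hne => integral_annulus_angEnergy_ge hg ha hb c h1 h12
      (fun z hz1 hz2 => good z (hbad z hz1 hz2)) hne) N (Finset.range N) x (fun _ => 1) 1
    (Finset.card_range N) (Finset.nonempty_range_iff.2 (by omega)) one_pos (fun _ _ => le_rfl) hcov
  simp only [Finset.sum_const, Finset.card_range, nsmul_eq_mul, mul_one, one_mul, one_pow,
    div_one] at hR1 hR3
  have hVpos : 0 < V := by nlinarith
  have hR'0 : 0 < R' := by linarith
  have hpR : p / 2 ≤ R' * (M₂ * V) :=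
    hI.trans ((le_abs_self _).trans (hR2.trans (mul_le_mul_of_nonneg_left hJabs hR'0.le)))
  have hratio : κ * p / V ^ 2 ≤ R' / N := by
    rw [div_le_div_iff₀ (by positivity) (by linarith), hκ]
    have e : v / (2 * M₂) * p * N = (p / 2) * (N * v) / M₂ := by field_simp
    rw [e, div_le_iff₀ hM₂0]
    calc (p / 2) * (N * v) ≤ (R' * (M₂ * V)) * V := by gcongr
      _ = _ := by ring
  have hlog : Real.log κ + Real.log p - 2 * Real.log V ≤ Real.log (R' / N) := by
    have e : Real.log (κ * p / V ^ 2) = Real.log κ + Real.log p - 2 * Real.log V := by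
      rw [Real.log_div (by positivity) (by positivity), Real.log_mul hκ0.ne' (by linarith),
        Real.log_pow]
      norm_num
    rw [← e]
    exact Real.log_le_log (by positivity) hratio
  have hgain : 2 * Real.pi * (Real.log κ + Real.log p - 2 * Real.log V - 8)
      ≤ ∫ z, angEnergy g a b z := by
    refine le_trans ?_ (hR3.trans (setIntegral_le_integral iA
      (Eventually.of_forall (angEnergy_nonneg hg))))
    have : 0 ≤ 8 / (R' / (N : ℝ)) ^ 2 := by positivity
    exact mul_le_mul_of_nonneg_left (by linarith) (by positivity)
  have hlogV : 4 * Real.pi * Real.log V ≤ V / 16 - 4 * Real.pi * (1 + Real.log η) := by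
    have h1 := Real.log_le_sub_one_of_pos (mul_pos hη0 hVpos)
    rw [Real.log_mul hη0.ne' hVpos.ne'] at h1
    have h2 : 4 * Real.pi * (η * V) = V / 16 := by rw [hη]; field_simp; norm_num
    nlinarith
  rw [hC']
  linarith

end Conclusion

section Bridge
variable {u : ℂ → ℂ}

lemma norm_fderiv_norm_sq_le (hu : ContDiff ℝ (⊤ : ℕ∞) u) (z : ℂ) :
    ‖fderiv ℝ (fun w => ‖u w‖) z‖ ^ 2 ≤ modGrad2 (fun z => (u z).re) (fun z => (u z).im) z := by
  have du := smooth_differentiable hu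
  by_cases h0 : u z = 0
  · have hm : IsLocalMin (fun w => ‖u w‖) z :=
      Eventually.of_forall fun w => by simp [h0]
    rw [hm.fderiv_eq_zero]
    simpa using modGrad2_nonneg _ _ z
  · have dn : DifferentiableAt ℝ (fun w => ‖u w‖) z := (du z).norm ℝ h0
    have npos : 0 < ‖u z‖ := norm_pos_iff.2 h0
    have dre : Differentiable ℝ fun z => (u z).re := Complex.reCLM.differentiable.comp du
    have dim : Differentiable ℝ fun z => (u z).im := Complex.imCLM.differentiable.comp du
    have key : ∀ e : ℂ, fderiv ℝ (fun w => ‖u w‖) z e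
        = ((u z).re * dirD e (fun z => (u z).re) z + (u z).im * dirD e (fun z => (u z).im) z) / ‖u z‖ := by
      intro e
      have e1 : (fun w => ‖u w‖ * ‖u w‖) = fun w => (u w).re * (u w).re + (u w).im * (u w).im := by
        funext w
        rw [← sq, ← Complex.normSq_eq_norm_sq, Complex.normSq_apply]
      have h1 := (dn.hasFDerivAt.mul dn.hasFDerivAt).fderiv
      have h2 := (((dre z).hasFDerivAt.mul (dre z).hasFDerivAt).add
        ((dim z).hasFDerivAt.mul (dim z).hasFDerivAt)).fderiv
      have h3 : fderiv ℝ (fun w => ‖u w‖ * ‖u w‖) z e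
          = fderiv ℝ (fun w => (u w).re * (u w).re + (u w).im * (u w).im) z e := by rw [e1]
      have h1' := congrArg (fun l => l e) h1
      have h2' := congrArg (fun l => l e) h2
      simp only [add_apply, smul_apply, smul_eq_mul] at h1' h2'
      have h4 : ‖u z‖ * fderiv ℝ (fun w => ‖u w‖) z e + ‖u z‖ * fderiv ℝ (fun w => ‖u w‖) z e = _ :=
        h1'.symm.trans (h3.trans h2')
      rw [eq_div_iff npos.ne']
      simp only [dirD]
      linarith
    set f := fderiv ℝ (fun w => ‖u w‖) z with hf
    have hmg : modGrad2 (fun z => (u z).re) (fun z => (u z).im) z = f 1 ^ 2 + f Complex.I ^ 2 := by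
      rw [key, key]
      unfold modGrad2
      have : (u z).re * (u z).re + (u z).im * (u z).im = ‖u z‖ ^ 2 := by
        rw [← Complex.normSq_eq_norm_sq, Complex.normSq_apply]
      rw [this]
      field_simp
    rw [hmg]
    have hle : ‖f‖ ≤ Real.sqrt (f 1 ^ 2 + f Complex.I ^ 2) := by
      refine ContinuousLinearMap.opNorm_le_bound _ (Real.sqrt_nonneg _) fun w => ?_
      have e : f w = w.re * f 1 + w.im * f Complex.I := by
        conv_lhs => rw [show w = w.re • (1 : ℂ) + w.im • Complex.I by
          apply Complex.ext <;> simp]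
        rw [map_add, map_smul, map_smul]; rfl
      refine abs_le_of_sq_le_sq ?_ (by positivity)
      rw [mul_pow, Real.sq_sqrt (by positivity), ← Complex.normSq_eq_norm_sq, Complex.normSq_apply, e]
      nlinarith [sq_nonneg (w.re * f Complex.I - w.im * f 1)]
    calc ‖f‖ ^ 2 ≤ Real.sqrt (f 1 ^ 2 + f Complex.I ^ 2) ^ 2 := by gcongr
      _ = _ := Real.sq_sqrt (by positivity)

lemma gradSq_eq_grad2 (hu : Differentiable ℝ u) :
    gradSq u = grad2 (fun z => (u z).re) fun z => (u z).im := by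
  funext z
  simp only [gradSq, grad2, pd1, pd2, dirD_re_comp hu, dirD_im_comp hu,
    ← Complex.normSq_eq_norm_sq, Complex.normSq_apply]
  ring

lemma sq_one_sub_eq_pot (z : ℂ) :
    (1 - ‖u z‖ ^ 2) ^ 2 = pot (fun z => (u z).re) (fun z => (u z).im) z := by
  simp only [pot, ← Complex.normSq_eq_norm_sq, Complex.normSq_apply]
  ring

lemma momDensity_eq_momDens (hu : Differentiable ℝ u) :
    momDensity u = momDens (fun z => (u z).re) fun z => (u z).im := by
  funext z
  simp only [momDensity, momDens, pd2, dirD_re_comp hu, dirD_im_comp hu]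
  simp
  ring

end Bridge

/-- uniform bound on the modulus gradient and potential energy. -/
theorem modulus_energy_bound (Λ₀ : ℝ) (hΛ₀ : 0 < Λ₀) :
    ∃ C p₀ : ℝ, 0 < C ∧ 0 < p₀ ∧ ∀ (u : ℂ → ℂ) (p c : ℝ), QuasiMin Λ₀ u p c → p₀ ≤ p →
        (∫ z : ℂ, ‖fderiv ℝ (fun w => ‖u w‖) z‖ ^ 2) + (1 / 2) * (∫ z : ℂ, (1 - ‖u z‖ ^ 2) ^ 2) ≤ C := by
  obtain ⟨C, p₀, hC, hp₀, H⟩ := modulus_energy_bound_real Λ₀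
  refine ⟨C, p₀, hC, hp₀, fun u p c ⟨⟨hu, hfin⟩, heven, hc, htw, hmi, hP, hE⟩ hp => ?_⟩
  have du := smooth_differentiable hu
  have rtw := realTW_of_TW hu htw
  let a : ℂ → ℝ := fun z => (u z).re
  let b : ℂ → ℝ := fun z => (u z).im
  have hpot : ∀ z, (1 - ‖u z‖ ^ 2) ^ 2 = pot a b z := sq_one_sub_eq_pot
  have hgrad : gradSq u = grad2 a b := gradSq_eq_grad2 du
  have hdens : energyDensity u = fun z => 1 / 2 * grad2 a b z + 1 / 4 * pot a b z := by
    funext z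
    rw [energyDensity, hgrad, hpot]
  have g0 : ∀ z, 0 ≤ grad2 a b z := fun z => by unfold grad2; positivity
  have v0 : ∀ z, 0 ≤ pot a b z := fun z => by unfold pot; positivity
  have cg : Continuous (grad2 a b) := by
    have := (dirD_contDiff rtw.smooth_re 1).continuous
    have := (dirD_contDiff rtw.smooth_re Complex.I).continuous
    have := (dirD_contDiff rtw.smooth_im 1).continuous
    have := (dirD_contDiff rtw.smooth_im Complex.I).continuous
    unfold grad2
    fun_prop
  have cv : Continuous (pot a b) := by
    have := rtw.smooth_re.continuous
    have := rtw.smooth_im.continuous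
    unfold pot
    fun_prop
  have ce : Continuous fun z => 1 / 2 * grad2 a b z + 1 / 4 * pot a b z := by fun_prop
  have e0 : ∀ z, 0 ≤ 1 / 2 * grad2 a b z + 1 / 4 * pot a b z := fun z => by
    linarith [g0 z, v0 z]
  have ie : Integrable fun z => 1 / 2 * grad2 a b z + 1 / 4 * pot a b z := by
    refine ⟨ce.aestronglyMeasurable, ?_⟩
    rw [hasFiniteIntegral_iff_ofReal (Eventually.of_forall e0)]
    simpa only [memE, energy, hdens] using hfin
  have ig : Integrable (grad2 a b) := by
    refine (ie.const_mul 2).mono' cg.aestronglyMeasurable (Eventually.of_forall fun z => ?_)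
    rw [Real.norm_of_nonneg (g0 z)]
    linarith [v0 z]
  have iv : Integrable (pot a b) := by
    refine (ie.const_mul 4).mono' cv.aestronglyMeasurable (Eventually.of_forall fun z => ?_)
    rw [Real.norm_of_nonneg (v0 z)]
    linarith [g0 z]
  have hmom : momDensity u = momDens a b := momDensity_eq_momDens du
  have fin : FinTW c a b :=
    { toRealTW := rtw
      speed_pos := hc
      int_grad := ig
      int_pot := iv
      int_mom := by rw [← hmom]; exact hmi }
  have hEfun : Efun u = 1 / 2 * (∫ z, grad2 a b z) + 1 / 4 * ∫ z, pot a b z := by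
    rw [Efun, energy, hdens, ← integral_eq_lintegral_of_nonneg_ae (Eventually.of_forall e0)
      ce.aestronglyMeasurable, integral_add (ig.const_mul _) (iv.const_mul _), integral_const_mul,
      integral_const_mul]
  obtain ⟨iD, hbound⟩ := H a b p c fin (fun z => congrArg Complex.re (heven z))
    (fun z => congrArg Complex.im (heven z)) (by rw [← hmom]; exact hP) (by rw [← hEfun]; exact hE) hp
  refine le_trans ?_ hbound
  simp only [hpot]
  exact add_le_add_left (integral_mono_of_nonneg (Eventually.of_forall fun z => sq_nonneg _) iD
    (Eventually.of_forall fun z => norm_fderiv_norm_sq_le hu z)) _
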